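/- Let X and Y be normal color Hopf subalgebras of a cocommutative color Hopf algebra A and [x,y] := φ(|x₂|,|y₁|) x₁ y₁ S(x₂) S(y₂). Then S([x,y]) = φ(|x|,|y|) [y,x] for all homogeneous x ∈ X, y ∈ Y; in particular the subalgebra [X,Y] is closed under the antipode. -/

import Mathlib

open TensorProduct

namespace ColorHopfPaper

variable (k : Type*) [Field k] (G : Type*) [CommGroup G]

/-- The "middle interchange" map `(A⊗A)⊗(B⊗B) → (A⊗B)⊗(A⊗B)` built from a braiding
`c : A⊗B → B⊗A` applied to the two middle factors. -/
noncomputable def midMap {A B : Type*} [AddCommGroup A] [Module k A]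
    [AddCommGroup B] [Module k B] (c : A ⊗[k] B →ₗ[k] B ⊗[k] A) :
    (A ⊗[k] A) ⊗[k] (B ⊗[k] B) →ₗ[k] (A ⊗[k] B) ⊗[k] (A ⊗[k] B) :=
  (TensorProduct.assoc k A B (A ⊗[k] B)).symm.toLinearMap ∘ₗ
    (TensorProduct.map LinearMap.id
      ((TensorProduct.assoc k B A B).toLinearMap ∘ₗ
        (TensorProduct.map c LinearMap.id) ∘ₗ
        (TensorProduct.assoc k A B B).symm.toLinearMap)) ∘ₗ
    (TensorProduct.assoc k A A (B ⊗[k] B)).toLinearMap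


/-- Generic Hopf kernel `{x : x₁ ⊗ f(x₂) = x ⊗ 1}` of `f`, for a comultiplication `Δ`. -/
noncomputable def hkerGen {X B : Type*} [AddCommGroup X] [Module k X]
    [AddCommGroup B] [Module k B]
    (Δ : X →ₗ[k] X ⊗[k] X) (f : X →ₗ[k] B) (oneB : B) : Submodule k X :=
  LinearMap.ker (((TensorProduct.map LinearMap.id f) ∘ₗ Δ) -
    (TensorProduct.mk k X B).flip oneB)

/-- A (cocommutative) color Hopf algebra: a cocommutative Hopf monoid in the symmetric
monoidal category of `G`-graded `k`-vector spaces, with braiding given by a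
skew-symmetric bicharacter `φ`. -/
structure ColorHopfAlg (H : Type*) [AddCommGroup H] [Module k H] where
  φ : G → G → k
  φ_ne : ∀ g h : G, φ g h ≠ 0
  φ_mul_left : ∀ g h l : G, φ (g * h) l = φ g l * φ h l
  φ_mul_right : ∀ g h l : G, φ g (h * l) = φ g h * φ g l
  φ_skew : ∀ g h : G, φ g h * φ h g = 1
  grade : G → Submodule k H
  grade_top : ⨆ g : G, grade g = ⊤
  mul : H ⊗[k] H →ₗ[k] H
  one : H
  comul : H →ₗ[k] H ⊗[k] H
  counit : H →ₗ[k] k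
  antipode : H →ₗ[k] H
  braid : H ⊗[k] H →ₗ[k] H ⊗[k] H
  braid_apply : ∀ (g h : G) (x y : H), x ∈ grade g → y ∈ grade h →
    braid (x ⊗ₜ[k] y) = φ g h • (y ⊗ₜ[k] x)
  one_mem : one ∈ grade 1
  mul_mem : ∀ (g h : G) (x y : H), x ∈ grade g → y ∈ grade h →
    mul (x ⊗ₜ[k] y) ∈ grade (g * h)
  antipode_mem : ∀ (g : G) (x : H), x ∈ grade g → antipode x ∈ grade g
  mul_assoc' : ∀ x y z : H,
    mul (mul (x ⊗ₜ[k] y) ⊗ₜ[k] z) = mul (x ⊗ₜ[k] mul (y ⊗ₜ[k] z))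
  one_mul' : ∀ x : H, mul (one ⊗ₜ[k] x) = x
  mul_one' : ∀ x : H, mul (x ⊗ₜ[k] one) = x
  coassoc : (TensorProduct.assoc k H H H).toLinearMap ∘ₗ
      (TensorProduct.map comul LinearMap.id) ∘ₗ comul
      = (TensorProduct.map LinearMap.id comul) ∘ₗ comul
  counit_left : ∀ x : H,
    (TensorProduct.lid k H) ((TensorProduct.map counit LinearMap.id) (comul x)) = x
  counit_right : ∀ x : H,
    (TensorProduct.rid k H) ((TensorProduct.map LinearMap.id counit) (comul x)) = x
  comul_one : comul one = one ⊗ₜ[k] one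
  counit_one : counit one = 1
  counit_mul : ∀ x y : H, counit (mul (x ⊗ₜ[k] y)) = counit x * counit y
  comul_mul : comul ∘ₗ mul =
    (TensorProduct.map mul mul) ∘ₗ midMap k braid ∘ₗ (TensorProduct.map comul comul)
  cocomm : braid ∘ₗ comul = comul
  antipode_left : ∀ x : H,
    mul ((TensorProduct.map antipode LinearMap.id) (comul x)) = counit x • one
  antipode_right : ∀ x : H,
    mul ((TensorProduct.map LinearMap.id antipode) (comul x)) = counit x • one

namespace ColorHopfAlg

variable {k G}
variable {H : Type*} [AddCommGroup H] [Module k H] (C : ColorHopfAlg k G H)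

/-- An element is homogeneous if it lies in one of the graded components. -/
def homogeneous (x : H) : Prop := ∃ g : G, x ∈ C.grade g

/-- The (color) adjoint action `ξ(a ⊗ b) = φ(|a₂|,|b|) a₁ b S(a₂)`. -/
noncomputable def adj : H ⊗[k] H →ₗ[k] H :=
  C.mul ∘ₗ
    (TensorProduct.map LinearMap.id
      (C.mul ∘ₗ (TensorProduct.map LinearMap.id C.antipode) ∘ₗ C.braid)) ∘ₗ
    (TensorProduct.assoc k H H H).toLinearMap ∘ₗ
    (TensorProduct.map C.comul LinearMap.id)

/-- The commutator `[x,y] = φ(|x₂|,|y₁|) x₁y₁S(x₂)S(y₂) = (x ▷ y₁) S(y₂)`. -/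
noncomputable def commMap : H ⊗[k] H →ₗ[k] H :=
  C.mul ∘ₗ (TensorProduct.map C.adj C.antipode) ∘ₗ
    (TensorProduct.assoc k H H H).symm.toLinearMap ∘ₗ
    (TensorProduct.map LinearMap.id C.comul)

/-- The comultiplication of the tensor-product (product) coalgebra `H ⊗ H`:
`x ⊗ y ↦ φ(|x₂|,|y₁|) (x₁⊗y₁)⊗(x₂⊗y₂)`. -/
noncomputable def comul2 : H ⊗[k] H →ₗ[k] (H ⊗[k] H) ⊗[k] (H ⊗[k] H) :=
  midMap k C.braid ∘ₗ TensorProduct.map C.comul C.comul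

/-- The counit of the tensor-product coalgebra `H ⊗ H`. -/
noncomputable def counit2 : H ⊗[k] H →ₗ[k] k :=
  (TensorProduct.lid k k).toLinearMap ∘ₗ TensorProduct.map C.counit C.counit

/-- `V` is a (graded) color Hopf subalgebra of `H`. -/
structure IsCHSub (V : Submodule k H) : Prop where
  one_mem : C.one ∈ V
  mul_mem : ∀ x ∈ V, ∀ y ∈ V, C.mul (x ⊗ₜ[k] y) ∈ V
  comul_mem : ∀ x ∈ V,
    C.comul x ∈ LinearMap.range (TensorProduct.map V.subtype V.subtype)
  antipode_mem : ∀ x ∈ V, C.antipode x ∈ V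
  graded : ∀ x ∈ V, x ∈ Submodule.span k {y : H | y ∈ V ∧ ∃ g : G, y ∈ C.grade g}

/-- `V` is normal: closed under the adjoint action of all of `H`. -/
def IsNormal (V : Submodule k H) : Prop :=
  ∀ a : H, ∀ x ∈ V, C.adj (a ⊗ₜ[k] x) ∈ V

/-- The subalgebra (as a submodule) generated by a set. -/
def genFrom (Sgen : Set H) : Submodule k H :=
  sInf {V : Submodule k H |
    Sgen ⊆ ↑V ∧ C.one ∈ V ∧ ∀ x ∈ V, ∀ y ∈ V, C.mul (x ⊗ₜ[k] y) ∈ V}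

/-- The commutator subalgebra `[X,Y]`, generated by all `[x,y]` with `x ∈ V`, `y ∈ W`. -/
def commSub (V W : Submodule k H) : Submodule k H :=
  C.genFrom {z : H | ∃ x ∈ V, ∃ y ∈ W, z = C.commMap (x ⊗ₜ[k] y)}

/-- The graded subspace `VW` spanned by products `vw`. -/
def prodSpan (V W : Submodule k H) : Submodule k H :=
  Submodule.span k {z : H | ∃ x ∈ V, ∃ y ∈ W, z = C.mul (x ⊗ₜ[k] y)}

/-- The Hopf kernel `Hker(f) = {x : x₁ ⊗ f(x₂) = x ⊗ 1}` of a map `f : H → B`. -/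
noncomputable def hkerOf {B : Type*} [AddCommGroup B] [Module k B]
    (CB : ColorHopfAlg k G B) (f : H →ₗ[k] B) : Submodule k H :=
  LinearMap.ker
    (((TensorProduct.map LinearMap.id f) ∘ₗ C.comul) -
      (TensorProduct.mk k H B).flip CB.one)

end ColorHopfAlg

/-- A morphism of color Hopf algebras. -/
structure IsColorHom {A B : Type*} [AddCommGroup A] [Module k A]
    [AddCommGroup B] [Module k B]
    (CA : ColorHopfAlg k G A) (CB : ColorHopfAlg k G B) (f : A →ₗ[k] B) : Prop where
  map_mul : ∀ x y : A, f (CA.mul (x ⊗ₜ[k] y)) = CB.mul (f x ⊗ₜ[k] f y)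
  map_one : f CA.one = CB.one
  map_comul : CB.comul ∘ₗ f = (TensorProduct.map f f) ∘ₗ CA.comul
  map_counit : CB.counit ∘ₗ f = CA.counit
  map_grade : ∀ g : G, ∀ x ∈ CA.grade g, f x ∈ CB.grade g

/-- A color Hopf crossed module `(A, H, d)`. -/
structure ColorCrossedMod {A H : Type*} [AddCommGroup A] [Module k A]
    [AddCommGroup H] [Module k H]
    (CA : ColorHopfAlg k G A) (CH : ColorHopfAlg k G H) where
  cAH : A ⊗[k] H →ₗ[k] H ⊗[k] A
  cHA : H ⊗[k] A →ₗ[k] A ⊗[k] H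
  cAH_apply : ∀ (g h : G) (a : A) (x : H), a ∈ CA.grade g → x ∈ CH.grade h →
    cAH (a ⊗ₜ[k] x) = CA.φ g h • (x ⊗ₜ[k] a)
  cHA_apply : ∀ (g h : G) (x : H) (a : A), x ∈ CH.grade g → a ∈ CA.grade h →
    cHA (x ⊗ₜ[k] a) = CH.φ g h • (a ⊗ₜ[k] x)
  φ_eq : CH.φ = CA.φ
  act : A ⊗[k] H →ₗ[k] H
  act_one_left : ∀ x : H, act (CA.one ⊗ₜ[k] x) = x
  act_act : ∀ (a b : A) (x : H),
    act (a ⊗ₜ[k] act (b ⊗ₜ[k] x)) = act (CA.mul (a ⊗ₜ[k] b) ⊗ₜ[k] x)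
  act_one : ∀ a : A, act (a ⊗ₜ[k] CH.one) = CA.counit a • CH.one
  counit_act : ∀ (a : A) (x : H),
    CH.counit (act (a ⊗ₜ[k] x)) = CA.counit a * CH.counit x
  comul_act : CH.comul ∘ₗ act =
    (TensorProduct.map act act) ∘ₗ midMap k cAH ∘ₗ
      (TensorProduct.map CA.comul CH.comul)
  act_mul : act ∘ₗ (TensorProduct.map LinearMap.id CH.mul) =
    CH.mul ∘ₗ (TensorProduct.map act act) ∘ₗ midMap k cAH ∘ₗ
      (TensorProduct.map CA.comul LinearMap.id)
  act_grade : ∀ (g h : G) (a : A) (x : H), a ∈ CA.grade g → x ∈ CH.grade h →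
    act (a ⊗ₜ[k] x) ∈ CH.grade (g * h)
  d : H →ₗ[k] A
  d_hom : IsColorHom k G CH CA d
  peiffer₁ : d ∘ₗ act = CA.adj ∘ₗ (TensorProduct.map LinearMap.id d)
  peiffer₂ : act ∘ₗ (TensorProduct.map d LinearMap.id) = CH.adj

namespace ColorCrossedMod

variable {k G}
variable {A H : Type*} [AddCommGroup A] [Module k A] [AddCommGroup H] [Module k H]
variable {CA : ColorHopfAlg k G A} {CH : ColorHopfAlg k G H}

/-- The multiplication of the semi-direct (smash) product `H ⋊ A`:
`(h⊗a)(h'⊗a') = φ(|a₂|,|h'|) h (a₁·h') ⊗ a₂a'`. -/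
noncomputable def smashMul (M : ColorCrossedMod k G CA CH) : (H ⊗[k] A) ⊗[k] (H ⊗[k] A) →ₗ[k] H ⊗[k] A :=
  (TensorProduct.map CH.mul CA.mul) ∘ₗ
  (TensorProduct.assoc k (H ⊗[k] H) A A).toLinearMap ∘ₗ
  (TensorProduct.map (TensorProduct.assoc k H H A).symm.toLinearMap LinearMap.id) ∘ₗ
  (TensorProduct.map
    (TensorProduct.map LinearMap.id (TensorProduct.map M.act LinearMap.id))
    LinearMap.id) ∘ₗ
  (TensorProduct.map
    ((TensorProduct.map LinearMap.id
        ((TensorProduct.assoc k A H A).symm.toLinearMap ∘ₗ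
          (TensorProduct.map LinearMap.id M.cAH) ∘ₗ
          (TensorProduct.assoc k A A H).toLinearMap)) ∘ₗ
      (TensorProduct.assoc k H (A ⊗[k] A) H).toLinearMap)
    LinearMap.id) ∘ₗ
  (TensorProduct.assoc k (H ⊗[k] (A ⊗[k] A)) H A).symm.toLinearMap ∘ₗ
  (TensorProduct.map (TensorProduct.map LinearMap.id CA.comul) LinearMap.id)

/-- The comultiplication of `H ⋊ A` (tensor-product coalgebra twisted by `φ`). -/
noncomputable def smashComul (M : ColorCrossedMod k G CA CH) : H ⊗[k] A →ₗ[k] (H ⊗[k] A) ⊗[k] (H ⊗[k] A) :=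
  midMap k M.cHA ∘ₗ TensorProduct.map CH.comul CA.comul

/-- The counit of `H ⋊ A`. -/
noncomputable def smashCounit (_M : ColorCrossedMod k G CA CH) : H ⊗[k] A →ₗ[k] k :=
  (TensorProduct.lid k k).toLinearMap ∘ₗ TensorProduct.map CH.counit CA.counit

end ColorCrossedMod


section Abstract

/-- linear functions, unbundled -/
@[fun_prop]
structure Lin (k : Type*) [Field k] {M N : Type*} [AddCommGroup M] [Module k M]
    [AddCommGroup N] [Module k N] (f : M → N) : Prop where
  add : ∀ x y, f (x + y) = f x + f y
  smul : ∀ (c : k) x, f (c • x) = c • f x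

namespace Lin

variable {k : Type*} [Field k] {L M N P : Type*} [AddCommGroup L] [Module k L]
  [AddCommGroup M] [Module k M]
  [AddCommGroup N] [Module k N] [AddCommGroup P] [Module k P]

def toL {f : M → N} (h : Lin k f) : M →ₗ[k] N :=
  { toFun := f, map_add' := h.add, map_smul' := h.smul }

@[simp] theorem toL_apply {f : M → N} (h : Lin k f) (x : M) : h.toL x = f x := rfl

theorem zero {f : M → N} (h : Lin k f) : f 0 = 0 := h.toL.map_zero
theorem sub {f : M → N} (h : Lin k f) (x y : M) : f (x - y) = f x - f y := h.toL.map_sub x y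
theorem sum {f : M → N} (h : Lin k f) {ι : Type*} (s : Finset ι) (g : ι → M) :
    f (∑ i ∈ s, g i) = ∑ i ∈ s, f (g i) := map_sum h.toL g s

@[fun_prop] theorem id' : Lin k (fun x : M => x) := ⟨fun _ _ => rfl, fun _ _ => rfl⟩
@[fun_prop] theorem const0 : Lin k (fun _ : M => (0 : N)) := ⟨by simp, by simp⟩
theorem comp' {g : N → P} {f : M → N} (hg : Lin k g) (hf : Lin k f) :
    Lin k (fun x => g (f x)) :=
  ⟨fun x y => by rw [hf.add, hg.add], fun c x => by rw [hf.smul, hg.smul]⟩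
attribute [fun_prop] comp'
@[fun_prop] theorem lmap (F : N →ₗ[k] P) : Lin k (fun x => F x) :=
  ⟨F.map_add, F.map_smul⟩
@[fun_prop] theorem add' {f g : M → N} (hf : Lin k f) (hg : Lin k g) :
    Lin k (fun x => f x + g x) :=
  ⟨fun x y => by rw [hf.add, hg.add]; abel, fun c x => by rw [hf.smul, hg.smul, smul_add]⟩
@[fun_prop] theorem sub' {f g : M → N} (hf : Lin k f) (hg : Lin k g) :
    Lin k (fun x => f x - g x) :=
  ⟨fun x y => by rw [hf.add, hg.add]; abel, fun c x => by rw [hf.smul, hg.smul, smul_sub]⟩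
@[fun_prop] theorem csmul {f : M → N} (c : k) (hf : Lin k f) :
    Lin k (fun x => c • f x) :=
  ⟨fun x y => by rw [hf.add, smul_add], fun d x => by rw [hf.smul, smul_comm]⟩
@[fun_prop] theorem smulc {f : M → k} (n : N) (hf : Lin k f) :
    Lin k (fun x => f x • n) :=
  ⟨fun x y => by rw [hf.add, add_smul], fun d x => by rw [hf.smul, smul_assoc]⟩
@[fun_prop] theorem tmulL {f : M → N} (n : P) (hf : Lin k f) :
    Lin k (fun x => f x ⊗ₜ[k] n) :=
  ⟨fun x y => by rw [hf.add, TensorProduct.add_tmul],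
   fun d x => by rw [hf.smul, TensorProduct.smul_tmul']⟩
@[fun_prop] theorem tmulR {f : M → N} (n : P) (hf : Lin k f) :
    Lin k (fun x => n ⊗ₜ[k] f x) :=
  ⟨fun x y => by rw [hf.add, TensorProduct.tmul_add],
   fun d x => by rw [hf.smul, TensorProduct.tmul_smul]⟩

theorem ext_basis {ι : Type*} (e : Module.Basis ι k M) {f g : M → N} (hf : Lin k f) (hg : Lin k g)
    (h : ∀ i, f (e i) = g (e i)) : ∀ x, f x = g x := fun x => by
  have : hf.toL = hg.toL := e.ext h
  exact LinearMap.congr_fun this x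

theorem ext_tensor {f g : M ⊗[k] N → P} (hf : Lin k f) (hg : Lin k g)
    (h : ∀ a b, f (a ⊗ₜ b) = g (a ⊗ₜ b)) : ∀ x, f x = g x := fun x => by
  have : hf.toL = hg.toL := TensorProduct.ext' h
  exact LinearMap.congr_fun this x

section alg
variable {H : Type*} [Ring H] [Algebra k H]
@[fun_prop] theorem mulL {f : M → H} (n : H) (hf : Lin k f) :
    Lin k (fun x => f x * n) :=
  ⟨fun x y => by rw [hf.add, add_mul],
   fun d x => by rw [hf.smul, smul_mul_assoc]⟩
@[fun_prop] theorem mulR {f : M → H} (n : H) (hf : Lin k f) :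
    Lin k (fun x => n * f x) :=
  ⟨fun x y => by rw [hf.add, mul_add],
   fun d x => by rw [hf.smul, mul_smul_comm]⟩
@[fun_prop] theorem ahom (F : H →ₐ[k] H) : Lin k (fun x => F x) :=
  ⟨map_add F, fun c x => map_smul F c x⟩
end alg
end Lin

/-- Coordinate version of a cocommutative color Hopf algebra. -/
structure CHA (ι k H : Type*) [Field k] [Ring H] [Algebra k H] where
  e : Module.Basis ι k H
  χ : ι → ι → k
  χ_skew : ∀ i j, χ i j * χ j i = 1
  T : ι → H →ₐ[k] H
  R : ι → H →ₐ[k] H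
  T_e : ∀ i j, T i (e j) = χ i j • e j
  R_e : ∀ i j, R i (e j) = χ j i • e j
  br : H ⊗[k] H →ₗ[k] H ⊗[k] H
  br_e : ∀ i j, br (e i ⊗ₜ e j) = χ i j • (e j ⊗ₜ e i)
  Δ : H →ₗ[k] H ⊗[k] H
  ε : H →ₗ[k] k
  S : H →ₗ[k] H
  S_T : ∀ i x, S (T i x) = T i (S x)
  S_R : ∀ i x, S (R i x) = R i (S x)
  coassoc' : (TensorProduct.assoc k H H H).toLinearMap ∘ₗ
      (TensorProduct.map Δ LinearMap.id) ∘ₗ Δ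
      = (TensorProduct.map LinearMap.id Δ) ∘ₗ Δ
  counit_left' : ∀ x : H,
    (TensorProduct.lid k H) ((TensorProduct.map ε LinearMap.id) (Δ x)) = x
  counit_right' : ∀ x : H,
    (TensorProduct.rid k H) ((TensorProduct.map LinearMap.id ε) (Δ x)) = x
  Δ_one : Δ 1 = 1 ⊗ₜ 1
  ε_one : ε 1 = 1
  ε_mul : ∀ x y, ε (x * y) = ε x * ε y
  Δ_mul' : Δ ∘ₗ LinearMap.mul' k H =
    (TensorProduct.map (LinearMap.mul' k H) (LinearMap.mul' k H)) ∘ₗ midMap k br ∘ₗ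
      (TensorProduct.map Δ Δ)
  cocomm' : ∀ x, br (Δ x) = Δ x
  S_left' : ∀ x, LinearMap.mul' k H ((TensorProduct.map S LinearMap.id) (Δ x)) = ε x • 1
  S_right' : ∀ x, LinearMap.mul' k H ((TensorProduct.map LinearMap.id S) (Δ x)) = ε x • 1

namespace CHA

variable {ι k H : Type*} [Field k] [Ring H] [Algebra k H] (D : CHA ι k H)
variable {L M N : Type*} [AddCommGroup L] [Module k L] [AddCommGroup M] [Module k M]
  [AddCommGroup N] [Module k N]

/-- evaluation of a (bilinear) function on a tensor -/
noncomputable def ev (t : H ⊗[k] H) (f : H → H → M) : M :=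
  ((D.e.tensorProduct D.e).repr t).sum (fun ij c => c • f (D.e ij.1) (D.e ij.2))

theorem ev_lin0 (f : H → H → M) : Lin k (fun t => D.ev t f) := by
  constructor
  · intro x y
    simp only [ev, map_add]
    rw [Finsupp.sum_add_index'] <;> simp [add_smul]
  · intro c x
    simp only [ev, map_smul]
    rw [Finsupp.sum_smul_index'] <;> simp [Finsupp.smul_sum, smul_smul]

@[fun_prop] theorem ev_linT {t : L → H ⊗[k] H} (f : H → H → M) (ht : Lin k t) :
    Lin k (fun x => D.ev (t x) f) := (D.ev_lin0 f).comp' ht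

@[fun_prop] theorem ev_linF (t : H ⊗[k] H) {f : L → H → H → M}
    (hf : ∀ a b, Lin k (fun x => f x a b)) :
    Lin k (fun x => D.ev t (f x)) := by
  constructor
  · intro x y
    simp only [ev, (hf _ _).add, smul_add, Finsupp.sum_add]
  · intro c x
    simp only [ev, (hf _ _).smul, Finsupp.smul_sum]
    exact Finset.sum_congr rfl (fun _ _ => smul_comm _ _ _)

theorem ev_basis (f : H → H → M) (i j : ι) : D.ev (D.e i ⊗ₜ D.e j) f = f (D.e i) (D.e j) := by
  rw [ev, ← Module.Basis.tensorProduct_apply, Module.Basis.repr_self, Finsupp.sum_single_index]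
  · simp
  · simp

theorem ev_tmul (a b : H) {f : H → H → M} (h1 : ∀ b, Lin k (fun a => f a b))
    (h2 : ∀ a, Lin k (fun b => f a b)) : D.ev (a ⊗ₜ b) f = f a b := by
  refine Lin.ext_basis D.e (f := fun a => D.ev (a ⊗ₜ b) f) (g := fun a => f a b)
    (by fun_prop) (by fun_prop) (fun i => ?_) a
  refine Lin.ext_basis D.e (f := fun b => D.ev (D.e i ⊗ₜ b) f) (g := fun b => f (D.e i) b)
    (by fun_prop) (by fun_prop) (fun j => ?_) b
  exact D.ev_basis f i j

theorem ev_comm (s t : H ⊗[k] H) (F : H → H → H → H → M) :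
    D.ev s (fun a b => D.ev t (fun p q => F a b p q)) =
    D.ev t (fun p q => D.ev s (fun a b => F a b p q)) := by
  simp only [ev, Finsupp.sum, Finset.smul_sum]
  rw [Finset.sum_comm]
  exact Finset.sum_congr rfl (fun _ _ => Finset.sum_congr rfl (fun _ _ => smul_comm _ _ _))

theorem ev_congr (t : H ⊗[k] H) {f g : H → H → M}
    (h : ∀ i j, f (D.e i) (D.e j) = g (D.e i) (D.e j)) : D.ev t f = D.ev t g := by
  simp only [ev, h]

theorem ev_map {F : M → N} (hF : Lin k F) (t : H ⊗[k] H) (f : H → H → M) :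
    F (D.ev t f) = D.ev t (fun a b => F (f a b)) := by
  simp only [ev, Finsupp.sum, hF.sum, hF.smul]

theorem ev_mk (t : H ⊗[k] H) : D.ev t (fun a b => a ⊗ₜ b) = t := by
  refine Lin.ext_tensor (f := fun t => D.ev t (fun a b => a ⊗ₜ b)) (g := fun t => t)
    (by fun_prop) (by fun_prop) (fun a b => ?_) t
  rw [ev_tmul] <;> intro <;> fun_prop

theorem ev_ev (t : H ⊗[k] H) (F : H → H → H ⊗[k] H) (f : H → H → M) :
    D.ev (D.ev t F) f = D.ev t (fun a b => D.ev (F a b) f) :=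
  D.ev_map (F := fun s => D.ev s f) (by fun_prop) t F

/-- apply a linear map to a tensor as an ev -/
theorem ev_of {F : H ⊗[k] H → M} (hF : Lin k F) (t : H ⊗[k] H) :
    F t = D.ev t (fun a b => F (a ⊗ₜ b)) := by
  conv_lhs => rw [← D.ev_mk t]
  exact D.ev_map hF _ _

/-- twisted evaluation -/
noncomputable def bt (a b : H) (f : H → H → M) : M :=
  D.ev (D.br (a ⊗ₜ b)) (fun b a => f a b)

@[fun_prop] theorem bt_linA {a : L → H} (b : H) (f : H → H → M) (ht : Lin k a) :
    Lin k (fun x => D.bt (a x) b f) := by unfold bt; fun_prop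
@[fun_prop] theorem bt_linB {b : L → H} (a : H) (f : H → H → M) (ht : Lin k b) :
    Lin k (fun x => D.bt a (b x) f) := by unfold bt; fun_prop
@[fun_prop] theorem bt_linF (a b : H) {f : L → H → H → M}
    (hf : ∀ a b, Lin k (fun x => f x a b)) :
    Lin k (fun x => D.bt a b (f x)) := by unfold bt; fun_prop

theorem bt_e (i j : ι) (f : H → H → M) :
    D.bt (D.e i) (D.e j) f = D.χ i j • f (D.e i) (D.e j) := by
  rw [bt, br_e, (D.ev_lin0 _).smul, ev_basis]

theorem bt_eL (i : ι) (p : H) {f : H → H → M} (h2 : ∀ a, Lin k (fun b => f a b)) :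
    D.bt (D.e i) p f = f (D.e i) (D.T i p) := by
  refine Lin.ext_basis D.e (f := fun p => D.bt (D.e i) p f) (g := fun p => f (D.e i) (D.T i p))
    (by fun_prop) (by fun_prop) (fun j => ?_) p
  simp only [bt_e, T_e, (h2 _).smul]

theorem bt_eR (j : ι) (a : H) {f : H → H → M} (h2 : ∀ b, Lin k (fun a => f a b)) :
    D.bt a (D.e j) f = f (D.R j a) (D.e j) := by
  refine Lin.ext_basis D.e (f := fun a => D.bt a (D.e j) f) (g := fun a => f (D.R j a) (D.e j))
    (by fun_prop) (by fun_prop) (fun i => ?_) a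
  simp only [bt_e, R_e, (h2 _).smul]

theorem bt_oneL (p : H) {f : H → H → M} (h1 : ∀ b, Lin k (fun a => f a b))
    (h2 : ∀ a, Lin k (fun b => f a b)) : D.bt 1 p f = f 1 p := by
  refine Lin.ext_basis D.e (f := fun p => D.bt 1 p f) (g := fun p => f 1 p)
    (by fun_prop) (by fun_prop) (fun j => ?_) p
  simp only [D.bt_eR _ _ h1, map_one]

theorem bt_oneR (p : H) {f : H → H → M} (h1 : ∀ b, Lin k (fun a => f a b))
    (h2 : ∀ a, Lin k (fun b => f a b)) : D.bt p 1 f = f p 1 := by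
  refine Lin.ext_basis D.e (f := fun p => D.bt p 1 f) (g := fun p => f p 1)
    (by fun_prop) (by fun_prop) (fun j => ?_) p
  simp only [D.bt_eL _ _ h2, map_one]

theorem bt_map {F : M → N} (hF : Lin k F) (a b : H) (f : H → H → M) :
    F (D.bt a b f) = D.bt a b (fun a b => F (f a b)) := D.ev_map hF _ _

/-- Sweedler sums -/
noncomputable def sw (x : H) (f : H → H → M) : M := D.ev (D.Δ x) f

@[fun_prop] theorem sw_linX {x : L → H} (f : H → H → M) (ht : Lin k x) :
    Lin k (fun y => D.sw (x y) f) := by unfold sw; fun_prop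
@[fun_prop] theorem sw_linF (x : H) {f : L → H → H → M}
    (hf : ∀ a b, Lin k (fun y => f y a b)) :
    Lin k (fun y => D.sw x (f y)) := by unfold sw; fun_prop

theorem sw_map {F : M → N} (hF : Lin k F) (x : H) (f : H → H → M) :
    F (D.sw x f) = D.sw x (fun a b => F (f a b)) := D.ev_map hF _ _

theorem sw_comm (x y : H) (F : H → H → H → H → M) :
    D.sw x (fun a b => D.sw y (fun p q => F a b p q)) =
    D.sw y (fun p q => D.sw x (fun a b => F a b p q)) := D.ev_comm _ _ _

theorem sw_congr (x : H) {f g : H → H → M}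
    (h : ∀ i j, f (D.e i) (D.e j) = g (D.e i) (D.e j)) : D.sw x f = D.sw x g :=
  D.ev_congr _ h

theorem sw_one {f : H → H → M} (h1 : ∀ b, Lin k (fun a => f a b))
    (h2 : ∀ a, Lin k (fun b => f a b)) : D.sw 1 f = f 1 1 := by
  rw [sw, Δ_one, ev_tmul _ _ _ h1 h2]

theorem counit_left (x : H) {f : H → M} (hf : Lin k f) :
    D.sw x (fun a b => D.ε a • f b) = f x := by
  conv_rhs => rw [← D.counit_left' x]
  rw [D.ev_of (F := fun t => f (TensorProduct.lid k H (TensorProduct.map D.ε LinearMap.id t)))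
    ⟨by simp [hf.add], by simp [hf.smul]⟩]
  simp [sw, hf.smul]

theorem counit_right (x : H) {f : H → M} (hf : Lin k f) :
    D.sw x (fun a b => D.ε b • f a) = f x := by
  conv_rhs => rw [← D.counit_right' x]
  rw [D.ev_of (F := fun t => f (TensorProduct.rid k H (TensorProduct.map LinearMap.id D.ε t)))
    ⟨by simp [hf.add], by simp [hf.smul]⟩]
  simp [sw, hf.smul]

theorem S_left (x : H) : D.sw x (fun a b => D.S a * b) = D.ε x • 1 := by
  rw [← D.S_left' x]
  rw [D.ev_of (F := fun t => LinearMap.mul' k H (TensorProduct.map D.S LinearMap.id t))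
    ⟨by simp, by simp⟩]
  simp [sw]

theorem S_right (x : H) : D.sw x (fun a b => a * D.S b) = D.ε x • 1 := by
  rw [← D.S_right' x]
  rw [D.ev_of (F := fun t => LinearMap.mul' k H (TensorProduct.map LinearMap.id D.S t))
    ⟨by simp, by simp⟩]
  simp [sw]

/-- evaluation of a trilinear function as linear map -/
theorem coassoc (x : H) (F : H → H → H → M) (h1 : ∀ b c, Lin k (fun a => F a b c))
    (h2 : ∀ a c, Lin k (fun b => F a b c)) (h3 : ∀ a b, Lin k (fun c => F a b c)) :
    D.sw x (fun a c => D.sw a (fun p q => F p q c)) =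
    D.sw x (fun a b => D.sw b (fun q c => F a q c)) := by
  let B : H →ₗ[k] (H ⊗[k] H) →ₗ[k] M := LinearMap.mk₂ k (fun a t => D.ev t (F a))
    (fun a b t => (D.ev_linF t (f := F) (fun b c => h1 b c)).add a b)
    (fun c a t => (D.ev_linF t (f := F) (fun b c => h1 b c)).smul c a)
    (fun a s t => (D.ev_lin0 (F a)).add s t)
    (fun c a t => (D.ev_lin0 (F a)).smul c t)
  have key := congrArg (TensorProduct.lift B) (LinearMap.congr_fun D.coassoc' x)
  simp only [LinearMap.comp_apply] at key
  have e1 := D.ev_of (F := fun t => TensorProduct.lift B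
    ((TensorProduct.map LinearMap.id D.Δ) t)) ⟨by simp, by simp⟩ (D.Δ x)
  have e2 := D.ev_of (F := fun t => TensorProduct.lift B ((TensorProduct.assoc k H H H).toLinearMap
    ((TensorProduct.map D.Δ LinearMap.id) t))) ⟨by simp, by simp⟩ (D.Δ x)
  rw [e1, e2] at key
  simp only [TensorProduct.map_tmul, TensorProduct.lift.tmul, LinearMap.id_apply] at key
  have e3 : ∀ (t : H ⊗[k] H) (c : H), TensorProduct.lift B
      ((TensorProduct.assoc k H H H).toLinearMap (t ⊗ₜ c)) = D.ev t (fun p q => F p q c) := by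
    intro t c
    refine Lin.ext_tensor (f := fun t => TensorProduct.lift B
      ((TensorProduct.assoc k H H H).toLinearMap (t ⊗ₜ c)))
      (g := fun t => D.ev t (fun p q => F p q c)) (by fun_prop) (by fun_prop) (fun a b => ?_) t
    simp only [LinearEquiv.coe_coe, TensorProduct.assoc_tmul, TensorProduct.lift.tmul]
    rw [ev_tmul]
    · show D.ev _ _ = _
      rw [ev_tmul] <;> intro <;> fun_prop
    · fun_prop
    · fun_prop
  simp only [e3] at key
  exact key

theorem cocomm (x : H) {f : H → H → M} : D.sw x f = D.sw x (fun a b => D.bt a b (fun a b => f b a)) := by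
  conv_lhs => rw [sw, ← D.cocomm', D.ev_of (F := fun t => D.ev (D.br t) f) (by fun_prop)]
  rfl

/-- braided product on the tensor square -/
noncomputable def m2 (s t : H ⊗[k] H) : H ⊗[k] H :=
  D.ev s fun a b => D.ev t fun p q => D.bt b p fun b p => (a * p) ⊗ₜ (b * q)

@[fun_prop] theorem m2_linL {s : L → H ⊗[k] H} (t : H ⊗[k] H) (h : Lin k s) :
    Lin k (fun x => D.m2 (s x) t) := by unfold m2; fun_prop
@[fun_prop] theorem m2_linR {t : L → H ⊗[k] H} (s : H ⊗[k] H) (h : Lin k t) :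
    Lin k (fun x => D.m2 s (t x)) := by unfold m2; fun_prop

theorem m2_tmul (a b p q : H) :
    D.m2 (a ⊗ₜ b) (p ⊗ₜ q) = D.bt b p fun b p => (a * p) ⊗ₜ[k] (b * q) := by
  unfold m2
  rw [ev_tmul]
  rw [ev_tmul]
  all_goals fun_prop

theorem Δ_mul (x y : H) : D.Δ (x * y) = D.m2 (D.Δ x) (D.Δ y) := by
  have h := LinearMap.congr_fun D.Δ_mul' (x ⊗ₜ y)
  simp only [LinearMap.comp_apply, LinearMap.mul'_apply, TensorProduct.map_tmul] at h
  rw [h]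
  generalize D.Δ x = s
  generalize D.Δ y = t
  refine Lin.ext_tensor (f := fun s => (TensorProduct.map (LinearMap.mul' k H)
    (LinearMap.mul' k H)) (midMap k D.br (s ⊗ₜ t))) (g := fun s => D.m2 s t) (by fun_prop)
    (by fun_prop) (fun a b => ?_) s
  refine Lin.ext_tensor (f := fun t => (TensorProduct.map (LinearMap.mul' k H)
    (LinearMap.mul' k H)) (midMap k D.br ((a ⊗ₜ b) ⊗ₜ t))) (g := fun s => D.m2 _ s) (by fun_prop)
    (by fun_prop) (fun p q => ?_) t
  rw [m2_tmul]
  simp only [midMap, LinearMap.comp_apply, LinearEquiv.coe_coe, TensorProduct.assoc_tmul,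
    TensorProduct.map_tmul, TensorProduct.assoc_symm_tmul, LinearMap.id_apply, bt]
  refine Lin.ext_tensor (f := fun t => (TensorProduct.map (LinearMap.mul' k H)
    (LinearMap.mul' k H)) ((TensorProduct.assoc k H H (H ⊗[k] H)).symm (a ⊗ₜ[k]
    (TensorProduct.assoc k H H H) (t ⊗ₜ[k] q))))
     (g := fun t => D.ev t fun b a_1 => (a * b) ⊗ₜ[k] (a_1 * q)) ⟨?_, ?_⟩
    (by fun_prop) (fun p q => ?_) _
  · intro x y; simp [TensorProduct.add_tmul, TensorProduct.tmul_add]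
  · intro x y; rw [← TensorProduct.smul_tmul']; simp
  rw [ev_tmul]
  · simp
  all_goals fun_prop

theorem cancelL {act : H → M → M} (h1 : ∀ m, Lin k (fun a => act a m))
    (h2 : ∀ a, Lin k (fun m => act a m)) (ha : ∀ a b m, act a (act b m) = act (a * b) m)
    (ho : ∀ m, act 1 m = m) {f g : H → M} (hf : Lin k f) (hg : Lin k g)
    (h : ∀ x, D.sw x (fun a b => act a (f b)) = D.sw x (fun a b => act a (g b))) :
    ∀ x, f x = g x := by
  have key : ∀ f : H → M, Lin k f → ∀ x,
      D.sw x (fun a b => act (D.S a) (D.sw b (fun q c => act q (f c)))) = f x := by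
    intro f hf x
    rw [← D.counit_left x hf]
    calc _ = D.sw x (fun a b => D.sw b (fun q c => act (D.S a) (act q (f c)))) := by
          congr 1; funext a b; exact D.sw_map (h2 _) _ _
      _ = D.sw x (fun a c => D.sw a (fun p q => act (D.S p) (act q (f c)))) := by
          rw [D.coassoc x (fun a q c => act (D.S a) (act q (f c)))] <;> intros <;> fun_prop
      _ = _ := by
          congr 1; funext a c
          simp only [ha]
          rw [← D.sw_map (F := fun z => act z (f c)) (by fun_prop), S_left, (h1 _).smul, ho]
  intro x
  rw [← key f hf, ← key g hg]
  simp only [h]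

theorem cancelR {act : M → H → M} (h1 : ∀ m, Lin k (fun a => act m a))
    (h2 : ∀ a, Lin k (fun m => act m a)) (ha : ∀ a b m, act (act m a) b = act m (a * b))
    (ho : ∀ m, act m 1 = m) {f g : H → M} (hf : Lin k f) (hg : Lin k g)
    (h : ∀ x, D.sw x (fun a b => act (f a) b) = D.sw x (fun a b => act (g a) b)) :
    ∀ x, f x = g x := by
  have key : ∀ f : H → M, Lin k f → ∀ x,
      D.sw x (fun a b => act (D.sw a (fun p q => act (f p) q)) (D.S b)) = f x := by
    intro f hf x
    rw [← D.counit_right x hf]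
    calc _ = D.sw x (fun a b => D.sw a (fun p q => act (act (f p) q) (D.S b))) := by
          congr 1; funext a b; exact D.sw_map (h2 _) _ _
      _ = D.sw x (fun a c => D.sw c (fun p q => act (act (f a) p) (D.S q))) := by
          rw [D.coassoc x (fun a q c => act (act (f a) q) (D.S c))] <;> intros <;> fun_prop
      _ = _ := by
          congr 1; funext a c
          simp only [ha]
          rw [← D.sw_map (F := fun z => act (f a) z) (by fun_prop), S_right, (h1 _).smul, ho]
  intro x
  rw [← key f hf, ← key g hg]
  simp only [h]


theorem χ_ne (i j : ι) : D.χ i j ≠ 0 := fun h => by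
  have := D.χ_skew i j
  rw [h, zero_mul] at this
  exact zero_ne_one this

/-- extensionality in basis for linear functions -/
theorem ext1 {f g : H → M} (hf : Lin k f) (hg : Lin k g)
    (h : ∀ i, f (D.e i) = g (D.e i)) (x : H) : f x = g x := Lin.ext_basis D.e hf hg h x

theorem RT (i : ι) (x : H) : D.R i (D.T i x) = x := by
  refine D.ext1 (f := fun x => D.R i (D.T i x)) (g := fun x => x) (by fun_prop) (by fun_prop)
    (fun j => ?_) x
  simp [T_e, R_e, smul_smul, χ_skew]

theorem TR (i : ι) (x : H) : D.T i (D.R i x) = x := by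
  refine D.ext1 (f := fun x => D.T i (D.R i x)) (g := fun x => x) (by fun_prop) (by fun_prop)
    (fun j => ?_) x
  simp [T_e, R_e, smul_smul, χ_skew]

theorem m2_eR (a b q : H) (j : ι) :
    D.m2 (a ⊗ₜ b) (D.e j ⊗ₜ q) = (a * D.e j) ⊗ₜ[k] (D.R j b * q) := by
  rw [m2_tmul, bt_eR]; intro; fun_prop

theorem m2_eL (a p q : H) (i : ι) :
    D.m2 (a ⊗ₜ D.e i) (p ⊗ₜ q) = (a * D.T i p) ⊗ₜ[k] (D.e i * q) := by
  rw [m2_tmul, bt_eL]; intro; fun_prop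

theorem m2_assoc (s t u : H ⊗[k] H) : D.m2 (D.m2 s t) u = D.m2 s (D.m2 t u) := by
  refine Lin.ext_tensor (f := fun s => D.m2 (D.m2 s t) u) (g := fun s => D.m2 s (D.m2 t u))
    (by fun_prop) (by fun_prop) (fun a b => ?_) s
  refine Lin.ext_tensor (f := fun t => D.m2 (D.m2 (a ⊗ₜ b) t) u)
    (g := fun t => D.m2 (a ⊗ₜ b) (D.m2 t u)) (by fun_prop) (by fun_prop) (fun p q => ?_) t
  refine Lin.ext_tensor (f := fun u => D.m2 (D.m2 (a ⊗ₜ b) (p ⊗ₜ q)) u)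
    (g := fun u => D.m2 (a ⊗ₜ b) (D.m2 (p ⊗ₜ q) u)) (by fun_prop) (by fun_prop) (fun r v => ?_) u
  refine D.ext1 (f := fun b => D.m2 (D.m2 (a ⊗ₜ b) (p ⊗ₜ q)) (r ⊗ₜ v))
    (g := fun b => D.m2 (a ⊗ₜ b) (D.m2 (p ⊗ₜ q) (r ⊗ₜ v))) (by fun_prop) (by fun_prop)
    (fun i => ?_) b
  refine D.ext1 (f := fun p => D.m2 (D.m2 (a ⊗ₜ D.e i) (p ⊗ₜ q)) (r ⊗ₜ v))
    (g := fun p => D.m2 (a ⊗ₜ D.e i) (D.m2 (p ⊗ₜ q) (r ⊗ₜ v))) (by fun_prop) (by fun_prop)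
    (fun j => ?_) p
  refine D.ext1 (f := fun r => D.m2 (D.m2 (a ⊗ₜ D.e i) (D.e j ⊗ₜ q)) (r ⊗ₜ v))
    (g := fun r => D.m2 (a ⊗ₜ D.e i) (D.m2 (D.e j ⊗ₜ q) (r ⊗ₜ v))) (by fun_prop) (by fun_prop)
    (fun l => ?_) r
  simp only [m2_eR, m2_eL, map_mul, R_e, T_e, map_smul]
  simp only [smul_mul_assoc, mul_smul_comm, TensorProduct.smul_tmul, TensorProduct.tmul_smul,
    smul_smul, mul_assoc]
  rw [mul_comm]

theorem m2_one_left (t : H ⊗[k] H) : D.m2 (1 ⊗ₜ 1) t = t := by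
  refine Lin.ext_tensor (f := fun t => D.m2 (1 ⊗ₜ 1) t) (g := fun t => t) (by fun_prop)
    (by fun_prop) (fun a b => ?_) t
  refine D.ext1 (f := fun a => D.m2 (1 ⊗ₜ 1) (a ⊗ₜ b)) (g := fun a => a ⊗ₜ b) (by fun_prop)
    (by fun_prop) (fun i => ?_) a
  simp [m2_eR]

theorem m2_tmul_one_right (a b q : H) : D.m2 (a ⊗ₜ b) (1 ⊗ₜ q) = a ⊗ₜ (b * q) := by
  rw [m2_tmul, bt_oneR]
  · simp
  all_goals fun_prop

theorem m2_tmul_one_left (a p q : H) : D.m2 (a ⊗ₜ 1) (p ⊗ₜ q) = (a * p) ⊗ₜ q := by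
  rw [m2_tmul, bt_oneL]
  · simp
  all_goals fun_prop

theorem m2_one_right (t : H ⊗[k] H) : D.m2 t (1 ⊗ₜ 1) = t := by
  refine Lin.ext_tensor (f := fun t => D.m2 t (1 ⊗ₜ 1)) (g := fun t => t) (by fun_prop)
    (by fun_prop) (fun a b => ?_) t
  simp [m2_tmul_one_right]

theorem sw_mul (x y : H) {f : H → H → M} (h1 : ∀ b, Lin k (fun a => f a b))
    (h2 : ∀ a, Lin k (fun b => f a b)) :
    D.sw (x * y) f = D.sw x fun a b => D.sw y fun p q => D.bt b p fun b p => f (a * p) (b * q) := by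
  rw [sw, Δ_mul, m2, ev_ev]
  congr 1; funext a b
  rw [ev_ev]
  congr 1; funext p q
  rw [D.bt_map (F := fun t => D.ev t f) (by fun_prop)]
  congr 1; funext b p
  rw [ev_tmul _ _ _ h1 h2]

theorem ε_R (i : ι) (x : H) : D.ε (D.R i x) = D.ε x := by
  have key : ∀ x, D.ε (D.R i x) • D.e i = D.ε x • D.e i := by
    refine D.cancelL (act := fun a m => a * m) (by fun_prop) (by fun_prop)
      (fun a b m => (mul_assoc _ _ _).symm) (by simp) (by fun_prop) (by fun_prop) (fun x => ?_)
    have h1 := D.counit_right (x * D.e i) (f := fun x => x) (by fun_prop)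
    rw [sw_mul _ _ _ (by fun_prop) (by fun_prop)] at h1
    simp only [ε_mul] at h1
    have h2 : ∀ a b, D.sw (D.e i) (fun p q => D.bt b p fun b p => (D.ε b * D.ε q) • (a * p))
        = a * D.ε (D.R i b) • D.e i := by
      intro a b
      have := D.counit_right (D.e i) (f := fun p => D.bt b p fun b p => D.ε b • (a * p))
        (by fun_prop)
      rw [bt_eR _ _ _ (by fun_prop)] at this
      rw [mul_smul_comm, ← this]
      congr 1; funext p q
      rw [D.bt_map (F := fun z => D.ε q • z) (by fun_prop)]
      congr 1; funext b p
      rw [smul_smul, mul_comm]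
    simp only [h2] at h1
    rw [h1]
    have := D.counit_right x (f := fun x => x * D.e i) (by fun_prop)
    rw [← this]
    congr 1; funext a b; rw [mul_smul_comm]
  have := key x
  rw [← sub_eq_zero, ← sub_smul, smul_eq_zero, sub_eq_zero] at this
  exact this.resolve_right (D.e.ne_zero i)

theorem ε_T (i : ι) (x : H) : D.ε (D.T i x) = D.ε x := by
  rw [← D.ε_R i (D.T i x), RT]

theorem S_mul (x y : H) : D.S (x * y) = D.bt x y (fun x y => D.S y * D.S x) := by
  let K : H → H → H := fun x y => D.S (x * y) - D.bt x y (fun x y => D.S y * D.S x)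
  have K1 : ∀ y, Lin k (fun x => K x y) := fun y => by simp only [K]; fun_prop
  have K2 : ∀ x, Lin k (fun y => K x y) := fun y => by simp only [K]; fun_prop
  have main : ∀ x y, D.sw y (fun p q => D.sw x (fun a b => D.bt b p (fun b p => K a p * b)) * q)
      = D.sw y (fun _ q => 0 * q) := by
    intro x y
    have hA := D.S_left (x * y)
    rw [sw_mul _ _ _ (by fun_prop) (by fun_prop), sw_comm, ε_mul] at hA
    have hB : D.sw y (fun p q => D.sw x (fun a b => D.bt b p (fun b p =>
        D.bt a p (fun a p => D.S p * D.S a) * b)) * q) = (D.ε x * D.ε y) • 1 := by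
      rw [mul_smul, ← S_left, D.sw_map (F := fun z : H => D.ε x • z) (by fun_prop)]
      refine D.sw_congr _ (fun i j => ?_)
      have e1 : ∀ a b, D.bt b (D.e i) (fun b p =>
        D.bt a p (fun a p => D.S p * D.S a) * b) = D.S (D.e i) * D.R i (D.S a * b) := by
        intro a b
        rw [bt_eR _ _ _ (by fun_prop), bt_eR _ _ _ (by fun_prop), S_R, map_mul, mul_assoc]
      simp only [e1]
      rw [← D.sw_map (F := fun z => D.S (D.e i) * D.R i z) (by fun_prop), S_left]
      simp
    have : ∀ p q, D.sw x (fun a b => D.bt b p (fun b p => K a p * b)) * q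
        = D.sw x (fun a b => D.bt b p (fun b p => D.S (a * p) * (b * q))) -
          D.sw x (fun a b => D.bt b p (fun b p =>
            D.bt a p (fun a p => D.S p * D.S a) * b)) * q := by
      intro p q
      rw [D.sw_map (F := fun z => z * q) (by fun_prop), D.sw_map (F := fun z => z * q) (by fun_prop)]
      have : ∀ f g : H → H → H, D.sw x (fun a b => f a b) - D.sw x (fun a b => g a b) =
          D.sw x (fun a b => f a b - g a b) := by
        intro f g
        simp [sw, ev, smul_sub]
      rw [this]
      congr 1; funext a b
      refine D.ext1 (f := fun p => D.bt b p (fun b p => K a p * b) * q) (g := fun p =>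
        D.bt b p (fun b p => D.S (a * p) * (b * q)) -  D.bt b p (fun b p =>
            D.bt a p (fun a p => D.S p * D.S a) * b) * q) (by fun_prop) (by fun_prop)
            (fun i => ?_) p
      rw [bt_eR _ _ _ (by fun_prop), bt_eR _ _ _ (by fun_prop), bt_eR _ _ _ (by fun_prop)]
      simp [K, sub_mul, mul_assoc]
    simp only [this]
    have sub : ∀ f g : H → H → H, D.sw y (fun a b => f a b - g a b) =
        D.sw y (fun a b => f a b) - D.sw y (fun a b => g a b) := by
      intro f g
      simp [sw, ev, smul_sub]
    rw [sub, hA, hB]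
    simp [sw, ev]
  have s1 : ∀ x p, D.sw x (fun a b => D.bt b p (fun b p => K a p * b)) = 0 := fun x =>
    D.cancelR (act := fun m a => m * a) (by fun_prop) (by fun_prop) (fun a b m => mul_assoc _ _ _)
      (by simp) (f := fun p => D.sw x (fun a b => D.bt b p (fun b p => K a p * b)))
      (g := fun _ => 0) (by fun_prop) (by fun_prop) (main x)
  have s2 : ∀ i x, K x (D.e i) = 0 := fun i => by
    refine D.cancelR (act := fun m a => m * D.R i a) (by fun_prop) (by fun_prop)
      (fun a b m => by simp [mul_assoc]) (by simp) (f := fun x => K x (D.e i)) (g := fun _ => 0)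
      (by fun_prop) (by fun_prop) (fun x => ?_)
    have := s1 x (D.e i)
    have e : ∀ a b, D.bt b (D.e i) (fun b p => K a p * b) = K a (D.e i) * D.R i b := fun a b =>
      D.bt_eR i _ (f := fun b p => K a p * b) (by fun_prop)
    simp only [e] at this
    rw [this]; simp [sw, ev]
  have s3 : ∀ x y, K x y = 0 := fun x => D.ext1 (by fun_prop) (by fun_prop) (fun i => s2 i x)
  exact sub_eq_zero.1 (s3 x y)

theorem S_mul_eR (x : H) (i : ι) : D.S (x * D.e i) = D.S (D.e i) * D.S (D.R i x) := by
  rw [S_mul, bt_eR]; fun_prop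

theorem S_mul_eL (x : H) (i : ι) : D.S (D.e i * x) = D.S (D.T i x) * D.S (D.e i) := by
  rw [S_mul, bt_eL]; fun_prop

theorem S_one : D.S 1 = 1 := by
  have := D.S_left 1
  rw [sw_one _ (by fun_prop) (by fun_prop), ε_one] at this
  simpa using this

theorem S_S (x : H) : D.S (D.S x) = x := by
  have h1 : ∀ x, D.sw x (fun a b => D.S a * D.S (D.S b)) = D.ε x • 1 := by
    intro x
    have h := congrArg D.S (D.S_left x)
    rw [D.sw_map (F := fun z => D.S z) (by fun_prop), map_smul, S_one] at h
    rw [← h, cocomm]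
    refine D.sw_congr _ (fun i j => ?_)
    rw [bt_e, S_mul_eR, ← S_R, R_e]
    simp
  have h2 := D.counit_right x (f := fun x => x) (by fun_prop)
  have h3 : D.sw x (fun a b => a * D.sw b (fun p q => D.S p * D.S (D.S q))) = x := by
    simp only [h1]
    simpa using h2
  have h4 : ∀ a b, a * D.sw b (fun p q => D.S p * D.S (D.S q)) =
      D.sw b (fun p q => a * (D.S p * D.S (D.S q))) := fun a b =>
    D.sw_map (F := fun z => a * z) (by fun_prop) _ _
  simp only [h4] at h3
  rw [← D.coassoc x (fun a p q => a * (D.S p * D.S (D.S q))) (by fun_prop) (by fun_prop)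
    (by fun_prop)] at h3
  have h5 : ∀ a c, D.sw a (fun p q => p * (D.S q * D.S (D.S c))) = D.ε a • D.S (D.S c) := by
    intro a c
    simp only [← mul_assoc]
    rw [← D.sw_map (F := fun z => z * D.S (D.S c)) (by fun_prop), S_right]
    simp
  simp only [h5] at h3
  rw [D.counit_left x (f := fun c => D.S (D.S c)) (by fun_prop)] at h3
  exact h3

theorem coassoc4 (x : H) (G : H → H → H → H → M) (h1 : ∀ b c d, Lin k (fun a => G a b c d))
    (h2 : ∀ a c d, Lin k (fun b => G a b c d)) (h3 : ∀ a b d, Lin k (fun c => G a b c d))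
    (h4 : ∀ a b c, Lin k (fun d => G a b c d)) :
    D.sw x (fun a b => D.sw a (fun p q => D.sw b (fun r s => G p q r s))) =
    D.sw x (fun p t => D.sw t (fun u s => D.sw u (fun q r => G p q r s))) := by
  rw [D.coassoc x (fun p q b => D.sw b (fun r s => G p q r s)) (by fun_prop) (by fun_prop)
    (by fun_prop)]
  congr 1; funext p t
  rw [D.coassoc t (fun q r s => G p q r s) (by fun_prop) (by fun_prop)
    (by fun_prop)]

theorem Δ_S (x : H) : D.Δ (D.S x) = D.sw x (fun a b => D.S a ⊗ₜ D.S b) := by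
  refine D.cancelL (act := fun a m => D.m2 (D.Δ a) m) (by fun_prop) (by fun_prop)
    (fun a b m => by rw [← m2_assoc, Δ_mul]) (fun m => by rw [Δ_one, m2_one_left])
    (f := fun x => D.Δ (D.S x)) (g := fun x => D.sw x (fun a b => D.S a ⊗ₜ D.S b))
    (by fun_prop) (by fun_prop) (fun x => ?_) x
  have l : D.sw x (fun a b => D.m2 (D.Δ a) (D.Δ (D.S b))) = D.ε x • (1 ⊗ₜ 1) := by
    simp only [← Δ_mul]
    rw [← D.sw_map (F := fun z => D.Δ z) (by fun_prop), S_right, map_smul, Δ_one]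
  rw [l]
  have r1 : ∀ a b, D.m2 (D.Δ a) (D.sw b (fun a b => D.S a ⊗ₜ D.S b)) =
      D.sw a (fun p q => D.sw b (fun r s => D.bt q r (fun q r => (p * D.S r) ⊗ₜ[k] (q * D.S s)))) := by
    intro a b
    rw [D.ev_of (F := fun z => D.m2 z (D.sw b (fun a b => D.S a ⊗ₜ D.S b))) (by fun_prop)]
    congr 1; funext p q
    rw [D.sw_map (F := fun z => D.m2 _ z) (by fun_prop)]
    congr 1; funext r s
    refine D.ext1 (f := fun q => D.m2 (p ⊗ₜ[k] q) (D.S r ⊗ₜ[k] D.S s)) (g := fun q =>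
      D.bt q r fun q r => (p * D.S r) ⊗ₜ[k] (q * D.S s)) (by fun_prop) (by fun_prop) (fun i => ?_) q
    simp only [m2_eL]
    rw [bt_eL _ _ _ (by fun_prop), S_T]
  simp only [r1]
  rw [coassoc4 _ _ _ (by fun_prop) (by fun_prop) (by fun_prop) (by fun_prop)]
  have r2 : ∀ p s u, D.sw u (fun q r => D.bt q r (fun q r => (p * D.S r) ⊗ₜ[k] (q * D.S s))) =
      D.sw u (fun q r => (p * D.S q) ⊗ₜ[k] (r * D.S s)) := by
    intro p s u
    conv_rhs => rw [cocomm]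
  simp only [r2]
  rw [← coassoc4 _ _ _ (by fun_prop) (by fun_prop) (by fun_prop) (by fun_prop)]
  have r3 : ∀ a b, (D.sw a fun p q => D.sw b fun r s => (p * D.S q) ⊗ₜ[k] (r * D.S s)) =
      D.ε a • D.ε b • (1 ⊗ₜ 1) := by
    intro a b
    have : ∀ p q, (D.sw b fun r s => (p * D.S q) ⊗ₜ[k] (r * D.S s)) =
       D.ε b • (p * D.S q) ⊗ₜ[k] 1 := by
      intro p q
      rw [← D.sw_map (F := fun z => (p * D.S q) ⊗ₜ[k] z) (by fun_prop), S_right,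
        TensorProduct.tmul_smul]
    simp only [this]
    rw [← D.sw_map (F := fun z => D.ε b • (z ⊗ₜ[k] 1)) (by fun_prop), S_right,
        ← TensorProduct.smul_tmul', smul_comm]
  simp only [r3]
  rw [D.counit_left x (f := fun b => D.ε b • ((1 : H) ⊗ₜ[k] (1 : H))) (by fun_prop)]


/-- coordinate on the first leg -/
noncomputable def cd (j : ι) : H ⊗[k] M →ₗ[k] M :=
  (TensorProduct.lid k M).toLinearMap ∘ₗ TensorProduct.map (D.e.coord j) LinearMap.id

theorem cd_tmul (j : ι) (a : H) (m : M) : D.cd j (a ⊗ₜ[k] m) = D.e.coord j a • m := by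
  simp [cd]

theorem cd_ext {s t : H ⊗[k] M} (h : ∀ j, D.cd j s = D.cd j t) : s = t := by
  classical
  apply (TensorProduct.equivFinsuppOfBasisLeft (N := M) D.e).injective
  ext j
  have : ∀ s : H ⊗[k] M, TensorProduct.equivFinsuppOfBasisLeft D.e s j = D.cd j s := by
    intro s
    refine Lin.ext_tensor (f := fun s => TensorProduct.equivFinsuppOfBasisLeft D.e s j)
      (g := fun s => D.cd j s) ⟨by simp, by simp⟩ (by fun_prop) (fun a b => ?_) s
    simp [cd_tmul]
  rw [this, this, h]

theorem coord_swap (i j : ι) {f : ι → M} :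
    D.e.coord j (D.e i) • f i = D.e.coord j (D.e i) • f j := by
  by_cases h : i = j
  · rw [h]
  · simp [Module.Basis.coord_apply, h]

theorem ev_m2L (a : H) (t : H ⊗[k] H) {f : H → H → M} (h1 : ∀ b, Lin k (fun a => f a b))
    (h2 : ∀ a, Lin k (fun b => f a b)) :
    D.ev (D.m2 (a ⊗ₜ 1) t) f = D.ev t (fun c d => f (a * c) d) := by
  rw [D.ev_of (F := fun t => D.ev (D.m2 (a ⊗ₜ 1) t) f) (by fun_prop)]
  congr 1; funext c d
  rw [m2_tmul_one_left, ev_tmul _ _ _ h1 h2]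

theorem ev_m2R (b : H) (t : H ⊗[k] H) {f : H → H → M} (h1 : ∀ b, Lin k (fun a => f a b))
    (h2 : ∀ a, Lin k (fun b => f a b)) :
    D.ev (D.m2 t (1 ⊗ₜ b)) f = D.ev t (fun c d => f c (d * b)) := by
  rw [D.ev_of (F := fun t => D.ev (D.m2 t (1 ⊗ₜ b)) f) (by fun_prop)]
  congr 1; funext c d
  rw [m2_tmul_one_right, ev_tmul _ _ _ h1 h2]

/-- right multiplication on third leg -/
noncomputable def r3 (t : H ⊗[k] (H ⊗[k] H)) (q : H) : H ⊗[k] (H ⊗[k] H) :=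
  LinearMap.lTensor H (LinearMap.lTensor H (LinearMap.mulRight k q)) t

/-- left multiplication on first leg -/
noncomputable def l3 (a : H) (t : H ⊗[k] M) : H ⊗[k] M :=
  LinearMap.rTensor M (LinearMap.mulLeft k a) t

@[simp] theorem r3_tmul (a b c q : H) : r3 (k := k) (a ⊗ₜ (b ⊗ₜ c)) q = a ⊗ₜ (b ⊗ₜ (c * q)) := by
  simp [r3]

@[simp] theorem l3_tmul (a b : H) (m : M) : l3 (k := k) a (b ⊗ₜ m) = (a * b) ⊗ₜ m := by
  simp [l3]

@[fun_prop] theorem r3_lin1 {t : L → H ⊗[k] (H ⊗[k] H)} (q : H) (h : Lin k t) :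
    Lin k (fun x => r3 (t x) q) := by unfold r3; fun_prop
@[fun_prop] theorem l3_lin2 {t : L → H ⊗[k] M} (q : H) (h : Lin k t) :
    Lin k (fun x => l3 q (t x)) := by unfold l3; fun_prop
@[fun_prop] theorem r3_lin2 {q : L → H} (t : H ⊗[k] (H ⊗[k] H)) (h : Lin k q) :
    Lin k (fun x => r3 t (q x)) := by
  refine Lin.comp' (g := fun q => r3 t q) ?_ h
  induction t using TensorProduct.induction_on with
  | zero => simp only [r3, map_zero]; fun_prop
  | add s t hs ht =>
    simp only [r3, map_add] at hs ht ⊢; fun_prop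
  | tmul a s =>
    induction s using TensorProduct.induction_on with
    | zero => simp only [r3, TensorProduct.tmul_zero, map_zero]; fun_prop
    | add s t hs ht =>
      simp only [r3, TensorProduct.tmul_add, map_add] at hs ht ⊢; fun_prop
    | tmul b c => simp only [r3_tmul]; fun_prop
@[fun_prop] theorem l3_lin1 {q : L → H} (t : H ⊗[k] M) (h : Lin k q) :
    Lin k (fun x => l3 (q x) t) := by
  refine Lin.comp' (g := fun q => l3 q t) ?_ h
  induction t using TensorProduct.induction_on with
  | zero => simp only [l3, map_zero]; fun_prop
  | add s t hs ht =>
    simp only [l3, map_add] at hs ht ⊢; fun_prop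
  | tmul a s => simp only [l3_tmul]; fun_prop

theorem l3_act (a b : H) (t : H ⊗[k] M) : l3 a (l3 b t) = l3 (a * b) t := by
  refine Lin.ext_tensor (f := fun t => l3 a (l3 b t)) (g := fun t => l3 (a * b) t) (by fun_prop)
    (by fun_prop) (fun p m => ?_) t
  simp [mul_assoc]

theorem l3_one (t : H ⊗[k] M) : l3 1 t = t := by
  refine Lin.ext_tensor (f := fun t => l3 1 t) (g := fun t => t) (by fun_prop)
    (by fun_prop) (fun p m => ?_) t
  simp

theorem ext3 {f g : H ⊗[k] (H ⊗[k] H) → M} (hf : Lin k f) (hg : Lin k g)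
    (h : ∀ a b c, f (a ⊗ₜ (b ⊗ₜ c)) = g (a ⊗ₜ (b ⊗ₜ c))) : ∀ t, f t = g t :=
  Lin.ext_tensor hf hg (fun a s => Lin.ext_tensor (f := fun s => f (a ⊗ₜ s))
    (g := fun s => g (a ⊗ₜ s)) (by fun_prop) (by fun_prop) (fun b c => h a b c) s)

theorem r3_act (a b : H) (t : H ⊗[k] (H ⊗[k] H)) : r3 (r3 t a) b = r3 t (a * b) :=
  ext3 (f := fun t => r3 (r3 t a) b) (g := fun t => r3 t (a * b)) (by fun_prop) (by fun_prop)
    (fun p q r => by simp [mul_assoc]) t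

theorem r3_one (t : H ⊗[k] (H ⊗[k] H)) : r3 t 1 = t :=
  ext3 (f := fun t => r3 t 1) (g := fun t => t) (by fun_prop) (by fun_prop)
    (fun p q r => by simp) t

/-- associator -/
noncomputable def asc (t : H ⊗[k] H) (x : H) : H ⊗[k] (H ⊗[k] H) :=
  (TensorProduct.assoc k H H H).toLinearMap (t ⊗ₜ x)

@[simp] theorem asc_tmul (a b c : H) : asc (k := k) (a ⊗ₜ b) c = a ⊗ₜ (b ⊗ₜ c) := by simp [asc]

@[fun_prop] theorem asc_lin1 {t : L → H ⊗[k] H} (q : H) (h : Lin k t) :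
    Lin k (fun x => asc (t x) q) := by unfold asc; fun_prop
@[fun_prop] theorem asc_lin2 {q : L → H} (t : H ⊗[k] H) (h : Lin k q) :
    Lin k (fun x => asc t (q x)) := by unfold asc; fun_prop

theorem r3_asc (t : H ⊗[k] H) (b q : H) : r3 (asc t b) q = asc t (b * q) :=
  Lin.ext_tensor (f := fun t => r3 (asc t b) q) (g := fun t => asc t (b * q)) (by fun_prop)
    (by fun_prop) (fun u v => by simp) t

theorem r3_tmul' (a : H) (t : H ⊗[k] H) (q : H) : r3 (a ⊗ₜ t) q = a ⊗ₜ D.m2 t (1 ⊗ₜ q) :=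
  Lin.ext_tensor (f := fun t => r3 (a ⊗ₜ t) q) (g := fun t => a ⊗ₜ D.m2 t (1 ⊗ₜ q)) (by fun_prop)
    (by fun_prop) (fun u v => by simp [m2_tmul_one_right]) t

set_option maxHeartbeats 1000000 in
theorem F1 (x y : H) :
    D.sw x (fun a b => D.bt b y (fun b y => asc (D.m2 (D.Δ a) (D.Δ y)) b)) =
    D.sw x (fun a b => D.sw y (fun p q => D.bt b p (fun b p => (a * p) ⊗ₜ
      D.m2 (D.Δ b) (q ⊗ₜ 1)))) := by
  refine D.cancelR (act := fun m a => r3 m a) (by fun_prop) (by fun_prop)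
    (fun a b m => r3_act a b m) (fun m => r3_one m)
    (f := fun y => D.sw x (fun a b => D.bt b y (fun b y => asc (D.m2 (D.Δ a) (D.Δ y)) b)))
    (g := fun y => D.sw x (fun a b => D.sw y (fun p q => D.bt b p (fun b p => (a * p) ⊗ₜ
      D.m2 (D.Δ b) (q ⊗ₜ 1))))) (by fun_prop) (by fun_prop) (fun y => ?_) y
  have h := D.coassoc (x * y) (fun a b c => a ⊗ₜ[k] (b ⊗ₜ[k] c)) (by fun_prop) (by fun_prop)
    (by fun_prop)
  have e1 : ∀ a c, D.sw a (fun p q => p ⊗ₜ[k] (q ⊗ₜ[k] c)) = asc (D.Δ a) c := fun a c => by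
    rw [D.ev_of (F := fun t => asc t c) (by fun_prop)]; simp [sw]
  have e2 : ∀ a c : H, D.sw c (fun p q => a ⊗ₜ[k] (p ⊗ₜ[k] q)) = a ⊗ₜ[k] (D.Δ c) := fun a c => by
    rw [D.ev_of (F := fun t : H ⊗[k] H => a ⊗ₜ[k] t) (Lin.tmulR a Lin.id')]; simp [sw]
  simp only [e1, e2] at h
  rw [sw_mul _ _ _ (by fun_prop) (by fun_prop), sw_mul _ _ _ (by fun_prop) (by fun_prop)] at h
  have l : D.sw y (fun a b => r3 (D.sw x (fun a_1 b => D.bt b a (fun b y =>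
      asc (D.m2 (D.Δ a_1) (D.Δ y)) b))) b) = D.sw x fun a b => D.sw y fun p q => D.bt b p
        fun b p => asc (D.Δ (a * p)) (b * q) := by
    rw [sw_comm]
    congr 1; funext p q
    rw [D.sw_map (F := fun z => r3 z q) (by fun_prop)]
    congr 1; funext a b
    rw [D.bt_map (F := fun z => r3 z q) (by fun_prop)]
    simp only [r3_asc, Δ_mul]
  have r : D.sw y (fun a_1 b => r3 (D.sw x (fun a b => D.sw a_1 (fun p q => D.bt b p
        (fun b p => (a * p) ⊗ₜ D.m2 (D.Δ b) (q ⊗ₜ 1))))) b) =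
      D.sw x fun a b => D.sw y fun p q => D.bt b p fun b p => (a * p) ⊗ₜ[k] D.Δ (b * q) := by
    have : ∀ c q, r3 (D.sw x (fun a b => D.sw c (fun p q => D.bt b p
        (fun b p => (a * p) ⊗ₜ D.m2 (D.Δ b) (q ⊗ₜ 1))))) q =
        D.sw x (fun a b => D.sw c (fun p q' => D.bt b p
        (fun b p => (a * p) ⊗ₜ D.m2 (D.Δ b) (q' ⊗ₜ q)))) := by
      intro c q
      rw [D.sw_map (F := fun z => r3 z q) (by fun_prop)]
      congr 1; funext a b
      rw [D.sw_map (F := fun z => r3 z q) (by fun_prop)]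
      congr 1; funext p q'
      rw [D.bt_map (F := fun z => r3 z q) (by fun_prop)]
      congr 1; funext b p
      rw [D.r3_tmul', m2_assoc, m2_tmul_one_right, one_mul]
    simp only [this]
    rw [sw_comm]
    congr 1; funext a b
    rw [D.coassoc y (fun p q' q => D.bt b p (fun b p => (a * p) ⊗ₜ D.m2 (D.Δ b) (q' ⊗ₜ q)))
      (by fun_prop) (by fun_prop) (by fun_prop)]
    congr 1; funext p q
    rw [← D.bt_map (F := fun z => z) (by fun_prop)]
    conv_rhs => rw [bt]
    simp only [bt]
    rw [sw, ev_comm]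
    congr 1; funext p b
    simp only [Δ_mul]
    rw [D.ev_of (F := fun z => (a * p) ⊗ₜ[k] D.m2 (D.Δ b) z) (by fun_prop)]
  rw [l, r, h]

/-- slices of the comultiplication -/
noncomputable def qq (j : ι) (y : H) : H := D.cd j (D.Δ y)

theorem qq_eq (j : ι) (y : H) : D.qq j y = D.sw y (fun p q => D.e.coord j p • q) := by
  rw [qq, D.ev_of (F := fun z => D.cd j z) (by fun_prop)]
  simp [cd_tmul, sw]

theorem E0 (h : ι) (x : H) :
    D.sw (D.e h) (fun p q => D.sw x (fun a b => D.bt a p (fun a p =>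
      p ⊗ₜ[k] ((a * q) ⊗ₜ[k] D.R h b)))) =
    D.sw (D.e h) (fun p q => D.bt x p (fun x p => p ⊗ₜ[k] D.m2 (D.Δ x) (q ⊗ₜ 1))) := by
  refine D.cancelL (act := fun a m => l3 a m) (by fun_prop) (by fun_prop)
    (fun a b m => l3_act a b m) (fun m => l3_one m)
    (f := fun x => D.sw (D.e h) (fun p q => D.sw x (fun a b => D.bt a p (fun a p =>
      p ⊗ₜ[k] ((a * q) ⊗ₜ[k] D.R h b)))))
    (g := fun x => D.sw (D.e h) (fun p q => D.bt x p (fun x p => p ⊗ₜ[k] D.m2 (D.Δ x) (q ⊗ₜ 1))))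
     (by fun_prop) (by fun_prop) (fun x => ?_) x
  have hF := D.F1 x (D.e h)
  have e1 : ∀ a b, D.bt b (D.e h) (fun b y => asc (D.m2 (D.Δ a) (D.Δ y)) b) =
      D.sw a (fun u v => D.sw (D.e h) (fun p q => D.bt v p (fun v p => (u * p) ⊗ₜ[k] ((v * q) ⊗ₜ[k]
        D.R h b)))) := by
    intro a b
    rw [bt_eR _ _ _ (by fun_prop), m2, D.ev_map (F := fun z => asc z (D.R h b)) (by fun_prop)]
    congr 1; funext u v
    rw [D.ev_map (F := fun z => asc z (D.R h b)) (by fun_prop)]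
    congr 1; funext p q
    rw [D.bt_map (F := fun z => asc z (D.R h b)) (by fun_prop)]
    simp only [asc_tmul]
  simp only [e1] at hF
  rw [D.coassoc x (fun u v b => D.sw (D.e h) (fun p q => D.bt v p (fun v p => (u * p) ⊗ₜ[k]
    ((v * q) ⊗ₜ[k] D.R h b)))) (by fun_prop) (by fun_prop) (by fun_prop)] at hF
  have l : ∀ a b, l3 a (D.sw (D.e h) (fun p q => D.sw b (fun a b => D.bt a p (fun a p =>
      p ⊗ₜ[k] ((a * q) ⊗ₜ[k] D.R h b))))) = D.sw b (fun u v => D.sw (D.e h) (fun p q =>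
      D.bt u p (fun u p => (a * p) ⊗ₜ[k] ((u * q) ⊗ₜ[k] D.R h v)))) := by
    intro a b
    rw [D.sw_map (F := fun z => l3 a z) (by fun_prop), sw_comm]
    congr 1; funext p q
    rw [D.sw_map (F := fun z => l3 a z) (by fun_prop)]
    congr 1; funext u v
    rw [D.bt_map (F := fun z => l3 a z) (by fun_prop)]
    simp only [l3_tmul]
  simp only [l]
  rw [hF]
  congr 1; funext a b
  rw [D.sw_map (F := fun z => l3 a z) (by fun_prop)]
  congr 1; funext p q
  rw [D.bt_map (F := fun z => l3 a z) (by fun_prop)]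
  simp only [l3_tmul]

set_option maxHeartbeats 1000000 in
theorem E1 (h j : ι) (x : H) :
    D.sw x (fun a b => (D.R j a * D.qq j (D.e h)) ⊗ₜ[k] D.R h b) =
    D.m2 (D.Δ (D.R j x)) (D.qq j (D.e h) ⊗ₜ 1) := by
  have h0 := congrArg (D.cd j) (D.E0 h x)
  rw [D.sw_map (F := fun z => D.cd j z) (by fun_prop),
    D.sw_map (F := fun z => D.cd j z) (by fun_prop)] at h0
  rw [qq_eq]
  have l : D.sw x (fun a b => (D.R j a * D.sw (D.e h) (fun p q => D.e.coord j p • q))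
      ⊗ₜ[k] D.R h b) = D.sw (D.e h) (fun p q => D.e.coord j p • D.sw x (fun a b =>
        (D.R j a * q) ⊗ₜ[k] D.R h b)) := by
    have : ∀ p q, D.e.coord j p • D.sw x (fun a b =>
        (D.R j a * q) ⊗ₜ[k] D.R h b) = D.sw x (fun a b =>
        (D.R j a * (D.e.coord j p • q)) ⊗ₜ[k] D.R h b) := by
      intro p q
      rw [D.sw_map (F := fun z => D.e.coord j p • z) (by fun_prop)]
      congr 1; funext a b
      rw [mul_smul_comm, ← TensorProduct.smul_tmul']
    simp only [this]
    rw [sw_comm]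
    congr 1; funext a b
    rw [← D.sw_map (F := fun z => (D.R j a * z) ⊗ₜ[k] D.R h b) (by fun_prop)]
  have r : D.m2 (D.Δ (D.R j x)) (D.sw (D.e h) (fun p q => D.e.coord j p • q) ⊗ₜ 1) =
      D.sw (D.e h) (fun p q => D.e.coord j p • D.m2 (D.Δ (D.R j x)) (q ⊗ₜ 1)) := by
    rw [D.sw_map (F := fun z => D.m2 (D.Δ (D.R j x)) (z ⊗ₜ 1)) (by fun_prop)]
    congr 1; funext p q
    have hl : Lin k (fun q : H => D.m2 (D.Δ (D.R j x)) (q ⊗ₜ[k] (1 : H))) := by fun_prop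
    exact hl.smul _ _
  rw [l, r]
  have l2 : (D.sw (D.e h) fun a b => D.cd j (D.sw x fun a_1 b_1 => D.bt a_1 a fun a p => p ⊗ₜ[k]
      ((a * b) ⊗ₜ[k] (D.R h) b_1))) = D.sw (D.e h) (fun p q => D.e.coord j p • D.sw x (fun a b =>
        (D.R j a * q) ⊗ₜ[k] D.R h b)) := by
    refine D.sw_congr _ (fun i i' => ?_)
    rw [← D.coord_swap i j (f := fun j => D.sw x (fun a b =>
        (D.R j a * D.e i') ⊗ₜ[k] D.R h b))]
    rw [D.sw_map (F := fun z => D.cd j z) (by fun_prop),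
      D.sw_map (F := fun z => D.e.coord j (D.e i) • z) (by fun_prop)]
    congr 1; funext a b
    rw [bt_eR _ _ _ (by fun_prop), cd_tmul]
  have r2 : (D.sw (D.e h) fun a b => D.cd j (D.bt x a fun x p => p ⊗ₜ[k] D.m2 (D.Δ x) (b ⊗ₜ[k] 1)))
      = D.sw (D.e h) (fun p q => D.e.coord j p • D.m2 (D.Δ (D.R j x)) (q ⊗ₜ 1)) := by
    refine D.sw_congr _ (fun i i' => ?_)
    have e := D.bt_eR i x (f := fun x p => p ⊗ₜ[k] D.m2 (D.Δ x) (D.e i' ⊗ₜ[k] 1))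
      (by fun_prop)
    rw [e, cd_tmul]
    exact D.coord_swap i j (f := fun j => D.m2 (D.Δ (D.R j x)) (D.e i' ⊗ₜ 1))
  rw [← l2, ← r2, h0]


/-- Θ -/
noncomputable def Th (j : ι) (x : H) : H ⊗[k] H :=
  D.sw x (fun a b => D.m2 (D.S (D.R j a) ⊗ₜ 1) (D.Δ (D.R j b)))

@[fun_prop] theorem Th_lin {x : L → H} (j : ι) (h : Lin k x) :
    Lin k (fun y => D.Th j (x y)) := by unfold Th; fun_prop

theorem L2 (j : ι) (x : H) :
    D.sw x (fun a b => D.m2 (D.R j a ⊗ₜ 1) (D.Th j b)) = D.Δ (D.R j x) := by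
  have h : ∀ a b, D.m2 (D.R j a ⊗ₜ 1) (D.Th j b) = D.sw b (fun p q =>
      D.m2 (D.R j (a * D.S p) ⊗ₜ 1) (D.Δ (D.R j q))) := by
    intro a b
    rw [Th, D.sw_map (F := fun z => D.m2 (D.R j a ⊗ₜ 1) z) (by fun_prop)]
    congr 1; funext p q
    rw [← m2_assoc, m2_tmul_one_left, S_R, map_mul]
  simp only [h]
  rw [← D.coassoc x (fun a p q => D.m2 (D.R j (a * D.S p) ⊗ₜ 1) (D.Δ (D.R j q))) (by fun_prop)
    (by fun_prop) (by fun_prop)]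
  have h2 : ∀ a c, D.sw a (fun p q => D.m2 (D.R j (p * D.S q) ⊗ₜ 1) (D.Δ (D.R j c))) =
      D.ε a • D.Δ (D.R j c) := by
    intro a c
    have hl : Lin k (fun z => D.m2 (D.R j z ⊗ₜ 1) (D.Δ (D.R j c))) := by fun_prop
    rw [← D.sw_map hl, S_right, hl.smul, map_one, m2_one_left]
  simp only [h2]
  exact D.counit_left x (f := fun c => D.Δ (D.R j c)) (by fun_prop)

theorem L3 (j : ι) (z : H) : D.ev (D.Th j z) (fun c d => c * D.S d) = D.S (D.R j z) := by
  rw [Th, sw, ev_ev]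
  have h : ∀ a b, D.ev (D.m2 (D.S (D.R j a) ⊗ₜ 1) (D.Δ (D.R j b))) (fun c d => c * D.S d) =
      D.ε b • D.S (D.R j a) := by
    intro a b
    rw [ev_m2L _ _ _ (by fun_prop) (by fun_prop)]
    simp only [mul_assoc]
    have := D.S_right (D.R j b)
    rw [← D.ev_map (F := fun z => D.S (D.R j a) * z) (by fun_prop)]
    rw [sw] at this
    rw [this, ε_R, mul_smul_comm, mul_one]
  simp only [h]
  exact D.counit_right z (f := fun c => D.S (D.R j c)) (by fun_prop)

theorem Qlem (h j : ι) (x : H) :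
    D.qq j (D.e h) ⊗ₜ D.R h x = D.m2 (D.Th j x) (D.qq j (D.e h) ⊗ₜ 1) := by
  refine D.cancelL (act := fun a m => D.m2 (D.R j a ⊗ₜ 1) m) (by fun_prop) (by fun_prop)
    (fun a b m => by rw [← m2_assoc, m2_tmul_one_left, map_mul])
    (fun m => by rw [map_one, m2_one_left])
    (f := fun x => D.qq j (D.e h) ⊗ₜ D.R h x)
    (g := fun x => D.m2 (D.Th j x) (D.qq j (D.e h) ⊗ₜ 1)) (by fun_prop) (by fun_prop)
    (fun x => ?_) x
  simp only [m2_tmul_one_left, ← m2_assoc]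
  rw [← D.sw_map (F := fun z => D.m2 z (D.qq j (D.e h) ⊗ₜ 1)) (by fun_prop), L2, E1]

/-- Ψ -/
noncomputable def Ps (A : H →ₐ[k] H) (y : H) : H ⊗[k] H :=
  D.sw y (fun a b => D.m2 (D.Δ (A a)) (1 ⊗ₜ A (D.S b)))

@[fun_prop] theorem Ps_lin {x : L → H} (A : H →ₐ[k] H) (h : Lin k x) :
    Lin k (fun y => D.Ps A (x y)) := by unfold Ps; fun_prop

theorem Ps_spec (A : H →ₐ[k] H) (y : H) :
    D.sw y (fun a b => D.m2 (D.Ps A a) (1 ⊗ₜ A b)) = D.Δ (A y) := by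
  have h : ∀ a b, D.m2 (D.Ps A a) (1 ⊗ₜ A b) = D.sw a (fun p q =>
      D.m2 (D.Δ (A p)) (1 ⊗ₜ A (D.S q * b))) := by
    intro a b
    rw [Ps, D.sw_map (F := fun z => D.m2 z (1 ⊗ₜ A b)) (by fun_prop)]
    congr 1; funext p q
    rw [m2_assoc, m2_tmul_one_right, map_mul]
  simp only [h]
  rw [D.coassoc y (fun p q b => D.m2 (D.Δ (A p)) (1 ⊗ₜ A (D.S q * b))) (by fun_prop)
    (by fun_prop) (by fun_prop)]
  have h2 : ∀ p c, D.sw c (fun q b => D.m2 (D.Δ (A p)) (1 ⊗ₜ A (D.S q * b))) =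
      D.ε c • D.Δ (A p) := by
    intro p c
    have hl : Lin k (fun z => D.m2 (D.Δ (A p)) (1 ⊗ₜ A z)) := by fun_prop
    rw [← D.sw_map hl, S_left, hl.smul, map_one, m2_one_right]
  simp only [h2]
  exact D.counit_right y (f := fun c => D.Δ (A c)) (by fun_prop)

/-- A acts on everything as left braiding with x -/
def Rel (A : H →ₐ[k] H) (x : H) : Prop :=
  ∀ h, ∃ c : k, D.R h x = c • x ∧ A (D.e h) = c • D.e h

theorem Rel_T (i : ι) : D.Rel (D.T i) (D.e i) := fun h => ⟨D.χ i h, D.R_e _ _, D.T_e _ _⟩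

theorem Rel_TT (i j : ι) : D.Rel ((D.T i).comp (D.T j)) (D.e i * D.e j) := fun h =>
  ⟨D.χ i h * D.χ j h, by simp [R_e, smul_smul, mul_comm], by simp [T_e, smul_smul, mul_comm]⟩

/-- action used in L1 -/
noncomputable def a1 (t : H ⊗[k] (H ⊗[k] H)) (q : H) : H ⊗[k] (H ⊗[k] H) :=
  LinearMap.lTensor H ((D.m2_linL (s := fun x => x) (q ⊗ₜ[k] 1) Lin.id').toL) t

@[simp] theorem a1_tmul (a : H) (t : H ⊗[k] H) (q : H) :
    D.a1 (a ⊗ₜ t) q = a ⊗ₜ D.m2 t (q ⊗ₜ 1) := by simp [a1]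

@[fun_prop] theorem a1_lin1 {t : L → H ⊗[k] (H ⊗[k] H)} (q : H) (h : Lin k t) :
    Lin k (fun x => D.a1 (t x) q) := by unfold a1; fun_prop
@[fun_prop] theorem a1_lin2 {q : L → H} (t : H ⊗[k] (H ⊗[k] H)) (h : Lin k q) :
    Lin k (fun x => D.a1 t (q x)) := by
  refine Lin.comp' (g := fun q => D.a1 t q) ?_ h
  induction t using TensorProduct.induction_on with
  | zero => simp only [a1, map_zero]; fun_prop
  | add s t hs ht => simp only [a1, map_add] at hs ht ⊢; fun_prop
  | tmul a s => simp only [a1_tmul]; fun_prop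

theorem L1 (A : H →ₐ[k] H) (x : H) (hA : D.Rel A x) (j : ι) :
    asc (D.Ps A (D.e j)) x = D.e j ⊗ₜ D.Th j x := by
  let f2 : H →ₗ[k] H ⊗[k] (H ⊗[k] H) := D.e.constr k (fun j => D.e j ⊗ₜ D.Th j x)
  have hf2 : ∀ j, f2 (D.e j) = D.e j ⊗ₜ D.Th j x := fun j => by simp [f2]
  rw [← hf2]
  have aA : ∀ (s : H ⊗[k] H) (q : H), D.a1 (asc s x) q = asc (D.m2 s (1 ⊗ₜ A q)) x := by
    intro s q
    refine Lin.ext_tensor (f := fun s => D.a1 (asc s x) q)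
      (g := fun s => asc (D.m2 s (1 ⊗ₜ A q)) x) (by fun_prop) (by fun_prop) (fun u v => ?_) s
    refine D.ext1 (f := fun q => D.a1 (asc (u ⊗ₜ v) x) q)
      (g := fun q => asc (D.m2 (u ⊗ₜ v) (1 ⊗ₜ A q)) x) (by fun_prop) (by fun_prop) (fun i => ?_) q
    obtain ⟨c, h1, h2⟩ := hA i
    simp only [asc_tmul, a1_tmul, m2_eR, m2_tmul_one_right, h1, h2, mul_one]
    simp [TensorProduct.smul_tmul]
  refine D.cancelR (act := fun m a => D.a1 m a) (by fun_prop) (by fun_prop) ?_ ?_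
    (f := fun y => asc (D.Ps A y) x) (g := fun y => f2 y) (by fun_prop) (by fun_prop)
    (fun y => ?_) (D.e j)
  · intro a b m
    refine Lin.ext_tensor (f := fun m => D.a1 (D.a1 m a) b) (g := fun m => D.a1 m (a * b))
      (by fun_prop) (by fun_prop) (fun u v => ?_) m
    simp [m2_assoc, m2_tmul_one_left]
  · intro m
    refine Lin.ext_tensor (f := fun m => D.a1 m 1) (g := fun m => m)
      (by fun_prop) (by fun_prop) (fun u v => ?_) m
    simp [m2_one_right]
  simp only [aA]
  rw [← D.sw_map (F := fun z => asc z x) (by fun_prop), Ps_spec]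
  refine D.ext1 (f := fun y => asc (D.Δ (A y)) x) (g := fun y => D.sw y fun a b => D.a1 (f2 a) b)
    (by fun_prop) (by fun_prop) (fun h => ?_) y
  obtain ⟨c, h1, h2⟩ := hA h
  rw [h2]
  apply D.cd_ext
  intro j
  rw [D.sw_map (F := fun z => D.cd j z) (by fun_prop)]
  have e1 : (D.sw (D.e h) fun a b => D.cd j (D.a1 (f2 a) b)) =
      D.sw (D.e h) fun a b => D.m2 (D.Th j x) ((D.e.coord j a • b) ⊗ₜ 1) := by
    refine D.sw_congr _ (fun i i' => ?_)
    have hl : Lin k (fun z => D.m2 (D.Th j x) (z ⊗ₜ[k] (1 : H))) := by fun_prop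
    rw [hl.smul, ← D.coord_swap i j (f := fun j => D.m2 (D.Th j x) (D.e i' ⊗ₜ[k] (1 : H))), hf2,
      a1_tmul, cd_tmul]
  rw [e1, ← D.sw_map (F := fun z => D.m2 (D.Th j x) (z ⊗ₜ[k] (1 : H))) (by fun_prop), ← qq_eq,
    ← Qlem, h1, qq]
  have e2 : ∀ t : H ⊗[k] H, D.cd j (asc t x) = D.cd j t ⊗ₜ x := fun t =>
    Lin.ext_tensor (f := fun t => D.cd j (asc t x)) (g := fun t => D.cd j t ⊗ₜ x) (by fun_prop)
      (by fun_prop) (fun u v => by simp [cd_tmul, TensorProduct.smul_tmul']) t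
  rw [e2]
  simp [TensorProduct.smul_tmul']

/-- θ -/
noncomputable def th (A : H →ₐ[k] H) (j : ι) : H := D.cd j (D.Ps A (D.e j))

theorem Th_eq (A : H →ₐ[k] H) (x : H) (hA : D.Rel A x) (j : ι) :
    D.Th j x = D.th A j ⊗ₜ x := by
  have h := congrArg (D.cd j) (D.L1 A x hA j)
  have e2 : ∀ t : H ⊗[k] H, D.cd j (asc t x) = D.cd j t ⊗ₜ x := fun t =>
    Lin.ext_tensor (f := fun t => D.cd j (asc t x)) (g := fun t => D.cd j t ⊗ₜ x) (by fun_prop)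
      (by fun_prop) (fun u v => by simp [cd_tmul, TensorProduct.smul_tmul']) t
  rw [e2, cd_tmul] at h
  simp only [Module.Basis.coord_apply, Module.Basis.repr_self, Finsupp.single_eq_same,
    one_smul] at h
  exact h.symm

theorem tmul_inj (i : ι) {a b : M} (h : a ⊗ₜ[k] D.e i = b ⊗ₜ[k] D.e i) : a = b := by
  have := congrArg (fun t => (TensorProduct.rid k M) (TensorProduct.map LinearMap.id
    (D.e.coord i) t)) h
  simpa using this

theorem Ps_eq (i : ι) (j : ι) : D.Ps (D.T i) (D.e j) = D.e j ⊗ₜ D.th (D.T i) j := by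
  have h := D.L1 (D.T i) (D.e i) (D.Rel_T i) j
  rw [D.Th_eq _ _ (D.Rel_T i)] at h
  have h2 : asc (D.Ps (D.T i) (D.e j)) (D.e i) = asc (D.e j ⊗ₜ D.th (D.T i) j) (D.e i) := by
    rw [h, asc_tmul]
  exact D.tmul_inj i ((TensorProduct.assoc k H H H).injective h2)

theorem Ps_comp (A B : H →ₐ[k] H) (y : H) :
    D.Ps (A.comp B) y = D.ev (D.Ps B y) (fun a b => D.m2 (D.Ps A a) (1 ⊗ₜ A b)) := by
  refine D.cancelR (act := fun m a => D.m2 m (1 ⊗ₜ A (B a))) (by fun_prop) (by fun_prop)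
    (fun a b m => by rw [m2_assoc, m2_tmul_one_right, ← map_mul, ← map_mul])
    (fun m => by rw [map_one, map_one, m2_one_right])
    (f := fun y => D.Ps (A.comp B) y)
    (g := fun y => D.ev (D.Ps B y) (fun a b => D.m2 (D.Ps A a) (1 ⊗ₜ A b))) (by fun_prop)
    (by fun_prop) (fun y => ?_) y
  have h1 := D.Ps_spec (A.comp B) y
  simp only [AlgHom.comp_apply] at h1
  rw [h1]
  have h2 : ∀ (s : H ⊗[k] H) q, D.m2 (D.ev s (fun a b => D.m2 (D.Ps A a) (1 ⊗ₜ A b))) (1 ⊗ₜ A q) =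
      D.ev (D.m2 s (1 ⊗ₜ q)) (fun a b => D.m2 (D.Ps A a) (1 ⊗ₜ A b)) := by
    intro s q
    rw [ev_m2R _ _ _ (by fun_prop) (by fun_prop)]
    rw [D.ev_map (F := fun z => D.m2 z (1 ⊗ₜ A q)) (by fun_prop)]
    refine congrArg (D.ev s) (funext fun a => funext fun b => ?_)
    rw [m2_assoc, m2_tmul_one_right, map_mul]
  simp only [h2]
  let E : H ⊗[k] H → H ⊗[k] H := fun s => D.ev s (fun a b => D.m2 (D.Ps A a) ((1 : H) ⊗ₜ A b))
  have hE : Lin k E := D.ev_lin0 _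
  have h3 := D.sw_map hE y (fun a b => D.m2 (D.Ps B a) ((1 : H) ⊗ₜ B b))
  rw [Ps_spec] at h3
  refine Eq.trans ?_ h3
  exact (D.Ps_spec A (B y)).symm

theorem th_comp (i l j : ι) : D.th ((D.T i).comp (D.T l)) j =
    D.th (D.T i) j * D.T i (D.th (D.T l) j) := by
  conv_lhs => rw [th]
  rw [Ps_comp, Ps_eq, ev_tmul _ _ _ (by fun_prop) (by fun_prop), Ps_eq, m2_tmul_one_right, cd_tmul]
  simp

theorem Th_mul (j : ι) (x y : H) : D.Th j (x * y) = D.m2 (D.Th j x) (D.Th j y) := by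
  refine D.ext1 (f := fun x => D.Th j (x * y)) (g := fun x => D.m2 (D.Th j x) (D.Th j y))
    (by fun_prop) (by fun_prop) (fun i => ?_) x
  refine D.ext1 (f := fun y => D.Th j (D.e i * y)) (g := fun y => D.m2 (D.Th j (D.e i)) (D.Th j y))
    (by fun_prop) (by fun_prop) (fun l => ?_) y
  rw [D.Th_eq _ _ (D.Rel_T i), D.Th_eq _ _ (D.Rel_T l), D.Th_eq _ _ (D.Rel_TT i l), m2_eL, th_comp]

theorem TR_comm (i j : ι) (x : H) : D.T i (D.R j x) = D.R j (D.T i x) := by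
  refine D.ext1 (f := fun x => D.T i (D.R j x)) (g := fun x => D.R j (D.T i x)) (by fun_prop)
    (by fun_prop) (fun l => ?_) x
  simp [T_e, R_e, smul_smul, mul_comm]

theorem cen0 (j : ι) (x r : H) :
    D.sw r (fun p q => D.bt x p (fun x p => D.m2 (D.R j p ⊗ₜ 1) (D.m2 (D.Th j x) (D.Th j q)))) =
    D.m2 (D.Th j x) (D.Δ (D.R j r)) := by
  refine D.cancelL (act := fun a m => D.m2 (D.R j a ⊗ₜ 1) m) (by fun_prop) (by fun_prop)
    (fun a b m => by rw [← m2_assoc, m2_tmul_one_left, map_mul])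
    (fun m => by rw [map_one, m2_one_left])
    (f := fun x => D.sw r (fun p q => D.bt x p (fun x p => D.m2 (D.R j p ⊗ₜ 1)
      (D.m2 (D.Th j x) (D.Th j q)))))
    (g := fun x => D.m2 (D.Th j x) (D.Δ (D.R j r))) (by fun_prop) (by fun_prop)
    (fun x => ?_) x
  simp only [← m2_assoc]
  have hl : Lin k (fun z => D.m2 z (D.Δ (D.R j r))) := by fun_prop
  have h1 := D.sw_map hl x (fun a b => D.m2 (D.R j a ⊗ₜ (1 : H)) (D.Th j b))
  rw [L2, ← Δ_mul, ← map_mul, ← L2, sw_mul _ _ _ (by fun_prop) (by fun_prop)] at h1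
  refine Eq.trans ?_ h1
  refine congrArg (D.sw x) (funext fun a => funext fun b => ?_)
  rw [D.sw_map (F := fun z => D.m2 (D.R j a ⊗ₜ 1) z) (by fun_prop)]
  refine congrArg (D.sw r) (funext fun p => funext fun q => ?_)
  rw [D.bt_map (F := fun z => D.m2 (D.R j a ⊗ₜ 1) z) (by fun_prop)]
  refine congrArg (D.bt b p) (funext fun b => funext fun p => ?_)
  rw [Th_mul, map_mul, m2_assoc, ← m2_assoc _ (D.R j a ⊗ₜ 1), m2_tmul_one_left]

set_option maxHeartbeats 1000000 in
theorem central (i j : ι) (r : H) : r * D.th (D.T i) j = D.th (D.T i) j * r := by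
  set θ := D.th (D.T i) j with hθ
  let f : H → H := fun p => D.T i (D.R j p) * θ - θ * D.T i (D.R j p)
  have hf : Lin k f := by simp only [f]; fun_prop
  have sub : ∀ (r : H) (f g : H → H → H ⊗[k] H), D.sw r (fun a b => f a b - g a b) =
      D.sw r (fun a b => f a b) - D.sw r (fun a b => g a b) := by
    intro r f g
    simp [sw, ev, smul_sub]
  have h1 : ∀ r, D.sw r (fun p q => D.m2 (f p ⊗ₜ D.e i) (D.Th j q)) = 0 := by
    intro r
    have h0 := D.cen0 j (D.e i) r
    rw [← L2, D.sw_map (F := fun z => D.m2 _ z) (by fun_prop), ← sub_eq_zero, ← sub] at h0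
    rw [← h0]
    congr 1; funext p q
    rw [bt_eL _ _ _ (by fun_prop), ← m2_assoc, ← m2_assoc, D.Th_eq _ _ (D.Rel_T i),
      m2_tmul_one_left, m2_eL, mul_one, ← TR_comm, ← Lin.sub (f := fun s => D.m2 s (D.Th j q))
        (by fun_prop), ← TensorProduct.sub_tmul]
  let F : H → H := fun r => D.sw r (fun a b => f a * D.T i (D.S (D.R j b)))
  have hF : Lin k F := by simp only [F]; fun_prop
  have h2 : ∀ r, F r ⊗ₜ[k] D.e i = 0 := by
    refine D.cancelR (act := fun m a => D.m2 m (D.Δ (D.R j a))) (by fun_prop) (by fun_prop)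
      (fun a b m => by rw [m2_assoc, ← Δ_mul, ← map_mul (D.R j)])
      (fun m => by rw [map_one, Δ_one, m2_one_right]) (f := fun r => F r ⊗ₜ[k] D.e i)
      (g := fun _ => 0) (by fun_prop) (by fun_prop) (fun r => ?_)
    have e1 : ∀ a b, D.m2 (F a ⊗ₜ D.e i) (D.Δ (D.R j b)) = D.sw a (fun p q =>
        D.m2 ((f p * D.T i (D.S (D.R j q))) ⊗ₜ D.e i) (D.Δ (D.R j b))) := fun a b =>
      D.sw_map (F := fun z => D.m2 (z ⊗ₜ D.e i) (D.Δ (D.R j b))) (by fun_prop) _ _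
    simp only [e1]
    rw [D.coassoc r (fun p q b => D.m2 ((f p * D.T i (D.S (D.R j q))) ⊗ₜ D.e i) (D.Δ (D.R j b)))
      (by fun_prop) (by fun_prop) (by fun_prop)]
    have e2 : ∀ p c, D.sw c (fun q b => D.m2 ((f p * D.T i (D.S (D.R j q))) ⊗ₜ D.e i)
        (D.Δ (D.R j b))) = D.m2 (f p ⊗ₜ D.e i) (D.Th j c) := by
      intro p c
      rw [Th, D.sw_map (F := fun z => D.m2 _ z) (by fun_prop)]
      congr 1; funext q b
      rw [← m2_assoc, m2_eL, mul_one]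
    simp only [e2]
    rw [h1]
    simp [m2, sw, ev]
  have h3 : ∀ r, F r = 0 := fun r => D.tmul_inj i (by rw [h2, TensorProduct.zero_tmul])
  have h4 : ∀ r, f r = 0 := by
    intro r
    have e1 : D.sw r (fun a b => F a * D.T i (D.R j b)) = 0 := by simp [h3, sw, ev]
    have e2 : ∀ a b, F a * D.T i (D.R j b) = D.sw a (fun p q =>
        f p * D.T i (D.R j (D.S q * b))) := by
      intro a b
      simp only [F]
      rw [D.sw_map (F := fun z => z * D.T i (D.R j b)) (by fun_prop)]
      congr 1; funext p q
      rw [S_R, mul_assoc, ← map_mul, ← map_mul]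
    simp only [e2] at e1
    rw [D.coassoc r (fun p q b => f p * D.T i (D.R j (D.S q * b))) (by fun_prop) (by fun_prop)
      (by fun_prop)] at e1
    have e3 : ∀ p c, D.sw c (fun q b => f p * D.T i (D.R j (D.S q * b))) = D.ε c • f p := by
      intro p c
      rw [← D.sw_map (F := fun z => f p * D.T i (D.R j z)) (by fun_prop), S_left]
      simp
    simp only [e3] at e1
    rwa [D.counit_right r hf] at e1
  have := h4 (D.T j (D.R i r))
  simp only [f] at this
  rw [D.RT, D.TR] at this
  exact sub_eq_zero.1 this

/-- diagonal algebra maps -/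
structure Diag (A : H →ₐ[k] H) : Prop where
  eig : ∀ i, ∃ c : k, c ≠ 0 ∧ A (D.e i) = c • D.e i
  S : ∀ x, A (D.S x) = D.S (A x)

theorem Diag_id : D.Diag (AlgHom.id k H) := ⟨fun i => ⟨1, one_ne_zero, by simp⟩, fun x => rfl⟩
theorem Diag_T (i : ι) : D.Diag (D.T i) := ⟨fun j => ⟨_, D.χ_ne _ _, D.T_e _ _⟩,
  fun x => (D.S_T i x).symm⟩
theorem Diag_R (i : ι) : D.Diag (D.R i) := ⟨fun j => ⟨_, D.χ_ne _ _, D.R_e _ _⟩,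
  fun x => (D.S_R i x).symm⟩
theorem Diag.comp {D : CHA ι k H} {A B : H →ₐ[k] H} (hA : D.Diag A) (hB : D.Diag B) :
    D.Diag (A.comp B) := by
  refine ⟨fun i => ?_, fun x => by simp [hA.S, hB.S]⟩
  obtain ⟨c, hc, h⟩ := hA.eig i
  obtain ⟨d, hd, h'⟩ := hB.eig i
  exact ⟨d * c, mul_ne_zero hd hc, by simp [h, h', smul_smul]⟩

theorem Diag.surj {D : CHA ι k H} {A : H →ₐ[k] H} (hA : D.Diag A) : Function.Surjective A := by
  have : LinearMap.range A.toLinearMap = ⊤ := by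
    rw [eq_top_iff, ← D.e.span_eq, Submodule.span_le]
    rintro _ ⟨i, rfl⟩
    obtain ⟨c, hc, h⟩ := hA.eig i
    exact ⟨c⁻¹ • D.e i, by simp [h, smul_smul, hc]⟩
  exact LinearMap.range_eq_top.1 this

theorem Om0 {A B : H →ₐ[k] H} (hA : D.Diag A) (hB : D.Diag B) (r : H) (j : ι) (z : H) :
    D.ev (D.Th j z) (fun c d => A c * r * D.S (B d)) = r * D.S (B (D.R j z)) := by
  refine D.ext1 (f := fun z => D.ev (D.Th j z) (fun c d => A c * r * D.S (B d)))
    (g := fun z => r * D.S (B (D.R j z))) (by fun_prop) (by fun_prop) (fun i => ?_) z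
  have h3 := D.L3 j (D.e i)
  rw [D.Th_eq _ _ (D.Rel_T i), ev_tmul _ _ _ (by fun_prop) (by fun_prop), R_e, map_smul] at h3
  rw [D.Th_eq _ _ (D.Rel_T i), ev_tmul _ _ _ (by fun_prop) (by fun_prop)]
  obtain ⟨c, hc, h⟩ := hA.eig i
  obtain ⟨d, hd, h'⟩ := hB.eig i
  obtain ⟨r', rfl⟩ := hA.surj r
  rw [← map_mul, ← central, map_mul]
  have h4 := congrArg A h3
  rw [map_mul, map_smul, hA.S, h] at h4
  simp only [map_smul, mul_smul_comm] at h4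
  rw [smul_comm] at h4
  have h5 := smul_right_injective H hc h4
  simp only [R_e, h', map_smul, mul_smul_comm, mul_assoc, h5]
  rw [smul_comm]

theorem Om {A B : H →ₐ[k] H} (hA : D.Diag A) (hB : D.Diag B) (r : H) (j : ι) (x : H) :
    D.sw (D.R j x) (fun a b => A a * r * D.S (B b)) =
    D.sw x (fun a b => A (D.R j a) * r * D.S (B (D.R j b))) := by
  rw [sw, ← L2, sw, ev_ev]
  congr 1; funext a b
  rw [ev_m2L _ _ _ (by fun_prop) (by fun_prop)]
  simp only [map_mul, mul_assoc]
  rw [← D.ev_map (F := fun z => A (D.R j a) * z) (by fun_prop), ← D.Om0 hA hB]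
  simp only [mul_assoc]

theorem OmT {A B : H →ₐ[k] H} (hA : D.Diag A) (hB : D.Diag B) (r : H) (j : ι) (x : H) :
    D.sw (D.T j x) (fun a b => A a * r * D.S (B b)) =
    D.sw x (fun a b => A (D.T j a) * r * D.S (B (D.T j b))) := by
  have := D.Om (hA.comp (D.Diag_T j)) (hB.comp (D.Diag_T j)) r j (D.T j x)
  simp only [AlgHom.comp_apply, RT, TR] at this
  exact this.symm


/-- adjoint action -/
noncomputable def adj (a r : H) : H := D.sw a (fun a b => D.bt b r (fun b r => a * (r * D.S b)))
/-- commutator -/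
noncomputable def comm (x y : H) : H := D.sw y (fun p q => D.adj x p * D.S q)

@[fun_prop] theorem adj_linL {a : L → H} (r : H) (h : Lin k a) :
    Lin k (fun x => D.adj (a x) r) := by unfold adj; fun_prop
@[fun_prop] theorem adj_linR {r : L → H} (a : H) (h : Lin k r) :
    Lin k (fun x => D.adj a (r x)) := by unfold adj; fun_prop
@[fun_prop] theorem comm_linL {a : L → H} (r : H) (h : Lin k a) :
    Lin k (fun x => D.comm (a x) r) := by unfold comm; fun_prop
@[fun_prop] theorem comm_linR {r : L → H} (a : H) (h : Lin k r) :
    Lin k (fun x => D.comm a (r x)) := by unfold comm; fun_prop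

theorem Diag.comm' {D : CHA ι k H} {A B : H →ₐ[k] H} (hA : D.Diag A) (hB : D.Diag B) (x : H) :
    A (B x) = B (A x) := by
  refine D.ext1 (f := fun x => A (B x)) (g := fun x => B (A x)) (by fun_prop) (by fun_prop)
    (fun l => ?_) x
  obtain ⟨c, hc, h⟩ := hA.eig l
  obtain ⟨d, hd, h'⟩ := hB.eig l
  simp [h, h', smul_smul, mul_comm]

/-- diagonal maps compatible with Ω -/
structure OA (Z : H →ₐ[k] H) : Prop extends D.Diag Z where
  om : ∀ {A B : H →ₐ[k] H}, D.Diag A → D.Diag B → ∀ r x : H,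
    D.sw (Z x) (fun a b => A a * r * D.S (B b)) = D.sw x (fun a b => A (Z a) * r * D.S (B (Z b)))

theorem OA_T (i : ι) : D.OA (D.T i) := ⟨D.Diag_T i, fun hA hB r x => D.OmT hA hB r i x⟩
theorem OA_R (i : ι) : D.OA (D.R i) := ⟨D.Diag_R i, fun hA hB r x => D.Om hA hB r i x⟩

theorem adj_e (a : H) (j : ι) : D.adj a (D.e j) = D.sw a (fun a b => a * D.e j * D.S (D.R j b)) := by
  unfold adj
  refine congrArg (D.sw a) (funext fun a => funext fun b => ?_)
  rw [bt_eR _ _ _ (by fun_prop), mul_assoc]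

theorem adj_one (r : H) : D.adj 1 r = r := by
  refine D.ext1 (f := fun r => D.adj 1 r) (g := fun r => r) (by fun_prop) (by fun_prop)
    (fun j => ?_) r
  rw [adj_e, sw_one _ (by fun_prop) (by fun_prop), map_one, S_one]
  simp

theorem adj_mul (z w r : H) : D.adj (z * w) r = D.adj z (D.adj w r) := by
  refine D.ext1 (f := fun r => D.adj (z * w) r) (g := fun r => D.adj z (D.adj w r))
    (by fun_prop) (by fun_prop) (fun j => ?_) r
  rw [adj_e, adj_e, D.sw_map (F := fun t => D.adj z t) (by fun_prop),
    sw_mul _ _ _ (by fun_prop) (by fun_prop), sw_comm]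
  refine congrArg (D.sw w) (funext fun p => funext fun q => ?_)
  unfold adj
  refine D.sw_congr _ fun l i => ?_
  rw [bt_eL _ _ _ (by fun_prop), bt_eL _ _ _ (by fun_prop)]
  simp only [map_mul, R_e, T_e, smul_mul_assoc, mul_smul_comm, map_smul, ← S_T, S_mul_eL, TR_comm,
    mul_assoc]

theorem adj_Z {Z : H →ₐ[k] H} (hZ : D.OA Z) (x r : H) : Z (D.adj x r) = D.adj (Z x) (Z r) := by
  refine D.ext1 (f := fun r => Z (D.adj x r)) (g := fun r => D.adj (Z x) (Z r)) (by fun_prop)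
    (by fun_prop) (fun j => ?_) r
  obtain ⟨c, hc, h⟩ := hZ.eig j
  have hl : Lin k (fun r => D.adj (Z x) r) := by fun_prop
  rw [h, hl.smul, adj_e, adj_e, D.sw_map (F := fun t => Z t) (by fun_prop)]
  have := hZ.om D.Diag_id (D.Diag_R j) (D.e j) x
  simp only [AlgHom.id_apply] at this
  have hl : Lin k (fun r : H => c • r) := by fun_prop
  rw [this, D.sw_map hl]
  refine congrArg (D.sw x) (funext fun a => funext fun b => ?_)
  rw [map_mul, map_mul, h, hZ.S, hZ.comm' (D.Diag_R j)]
  simp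

theorem comm_Z0 {Z : H →ₐ[k] H} (hZ : D.OA Z) (x y : H) :
    D.comm x (Z y) = D.sw y (fun p q => D.adj x (Z p) * D.S (Z q)) := by
  unfold comm adj
  have h1 : ∀ p q, (D.sw x fun a b => D.bt b p fun b r => a * (r * D.S b)) * D.S q =
    D.sw x (fun a b => (D.bt b p fun b r => a * (r * D.S b)) * D.S q) := fun p q =>
      D.sw_map (F := fun z => z * D.S q) (by fun_prop) _ _
  simp only [h1]
  rw [D.sw_comm (Z y) x, D.sw_comm y x]
  refine D.sw_congr _ fun i j => ?_
  have h2 : ∀ p, (D.bt (D.e j) p fun b r => D.e i * (r * D.S b)) =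
      D.e i * (D.T j p * D.S (D.e j)) := fun p => D.bt_eL _ _ (by fun_prop)
  simp only [h2]
  have := congrArg (fun z : H => D.e i * z) (hZ.om (D.Diag_T j) D.Diag_id (D.S (D.e j)) y)
  simp only [AlgHom.id_apply] at this
  have hl : Lin k (fun z : H => D.e i * z) := by fun_prop
  rw [D.sw_map hl, D.sw_map hl] at this
  simpa only [mul_assoc] using this

theorem comm_Z {Z : H →ₐ[k] H} (hZ : D.OA Z) (x y : H) : Z (D.comm x y) = D.comm (Z x) (Z y) := by
  rw [comm_Z0 _ hZ, comm, D.sw_map (F := fun t => Z t) (by fun_prop)]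
  simp only [map_mul, adj_Z _ hZ, hZ.S]

theorem adj_c (y t : H) : D.sw y (fun p q => D.bt q t (fun q t => D.adj p t * q)) = y * t := by
  refine D.ext1 (f := fun t => D.sw y (fun p q => D.bt q t (fun q t => D.adj p t * q)))
    (g := fun t => y * t) (by fun_prop) (by fun_prop) (fun j => ?_) t
  have h1 : ∀ p q, (D.bt q (D.e j) fun q t => D.adj p t * q) =
      D.sw p (fun a b => a * D.e j * D.S (D.R j b) * D.R j q) := by
    intro p q
    rw [bt_eR _ _ _ (by fun_prop), adj_e, D.sw_map (F := fun z => z * D.R j q) (by fun_prop)]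
  simp only [h1]
  rw [D.coassoc y (fun a b q => a * D.e j * D.S (D.R j b) * D.R j q) (by fun_prop) (by fun_prop)
    (by fun_prop)]
  have h2 : ∀ a c, D.sw c (fun b q => a * D.e j * D.S (D.R j b) * D.R j q) =
      D.ε c • (a * D.e j) := by
    intro a c
    have hl : Lin k (fun z => a * D.e j * D.R j z) := by fun_prop
    have := D.sw_map hl c (fun b q => D.S b * q)
    rw [S_left, hl.smul, map_one, mul_one] at this
    rw [this]
    refine congrArg (D.sw c) (funext fun b => funext fun q => ?_)
    rw [map_mul, S_R, mul_assoc (a * D.e j)]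
  simp only [h2]
  exact D.counit_right y (f := fun a => a * D.e j) (by fun_prop)

theorem comm_D (y : H) (g : ι) :
    D.comm y (D.e g) = D.sw y (fun p q => p * D.adj (D.e g) (D.S (D.R g q))) := by
  have h1 : D.comm y (D.e g) = D.sw y (fun p q => D.sw (D.e g) (fun a b => D.bt q a (fun q a =>
      p * (a * (D.S q * D.S b))))) := by
    rw [D.sw_comm]
    unfold comm adj
    refine congrArg (D.sw (D.e g)) (funext fun a => funext fun b => ?_)
    rw [D.sw_map (F := fun z => z * D.S b) (by fun_prop)]
    refine congrArg (D.sw y) (funext fun p => funext fun q => ?_)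
    rw [D.bt_map (F := fun z => z * D.S b) (by fun_prop)]
    simp only [mul_assoc]
  rw [h1]
  refine D.sw_congr _ fun l m => ?_
  have h2 : ∀ a b, (D.bt (D.e m) a fun q a => D.e l * (a * (D.S q * D.S b))) =
     D.e l * (D.T m a * D.S (D.e m) * D.S b) := by
    intro a b
    rw [bt_eL _ _ _ (by fun_prop), mul_assoc]
  simp only [h2]
  rw [← D.sw_map (F := fun z => D.e l * z) (by fun_prop)]
  refine congrArg (fun z => D.e l * z) ?_
  have h3 := D.OmT (D.Diag_id) (D.Diag_R m) (D.S (D.e m)) m (D.e g)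
  simp only [AlgHom.id_apply, RT] at h3
  have hl : Lin k (fun z => D.sw z (fun a b => a * D.S (D.e m) * D.S (D.R m b))) := by fun_prop
  rw [← h3, T_e, hl.smul]
  unfold adj
  have hl : Lin k (fun r : H => D.χ m g • r) := by fun_prop
  rw [D.sw_map hl]
  refine D.sw_congr _ fun i j => ?_
  rw [bt_eL _ _ _ (by fun_prop)]
  simp only [R_e, map_smul, ← S_T, T_e, smul_mul_assoc, mul_smul_comm, mul_assoc, smul_smul]
  
theorem adj_self (u : H) : D.sw u (fun a b => D.adj a b) = u := by
  unfold adj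
  rw [D.coassoc u (fun a q b => D.bt q b fun b r => a * (r * D.S b)) (by fun_prop) (by fun_prop)
    (by fun_prop)]
  have h : ∀ a c, (D.sw c fun q b => D.bt q b fun b r => a * (r * D.S b)) = D.ε c • a := by
    intro a c
    rw [← D.cocomm c (f := fun r b => a * (r * D.S b)), ← D.sw_map (F := fun z => a * z)
      (by fun_prop), S_right, mul_smul_comm, mul_one]
  simp only [h]
  exact D.counit_right u (f := fun a => a) (by fun_prop)

theorem sw_S (x : H) {f : H → H → M} (h1 : ∀ b, Lin k (fun a => f a b))
    (h2 : ∀ a, Lin k (fun b => f a b)) :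
    D.sw (D.S x) f = D.sw x (fun a b => f (D.S a) (D.S b)) := by
  rw [sw, Δ_S, sw, ev_ev]
  refine congrArg (D.ev (D.Δ x)) (funext fun b => funext fun q => ?_)
  rw [ev_tmul _ _ _ h1 h2]

theorem comm_J (y x : H) :
    D.comm y x = D.sw y (fun p q => D.bt q x (fun q x => D.comm (D.adj p x) (D.S q))) := by
  refine D.ext1 (f := fun x => D.comm y x) (g := fun x => D.sw y (fun p q => D.bt q x
    (fun q x => D.comm (D.adj p x) (D.S q)))) (by fun_prop) (by fun_prop) (fun g => ?_) x
  -- left side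
  have hL : D.comm y (D.e g) = D.sw y (fun p q => D.sw q (fun c b =>
      D.adj p (D.adj (D.e g) (D.S (D.R g c))) * D.R g b)) := by
    rw [comm_D]
    have h1 : ∀ p q, p * D.adj (D.e g) (D.S (D.R g q)) = D.sw p (fun u v => D.bt v q (fun v q =>
        D.adj u (D.adj (D.e g) (D.S (D.R g q))) * D.R g v)) := by
      intro p q
      rw [← D.adj_c]
      refine D.sw_congr _ fun l i => ?_
      have hl : Lin k (fun z => D.adj (D.e l) (D.adj z (D.S (D.R g (D.T i q)))) * D.e i) := by
        fun_prop
      rw [bt_eL _ _ _ (by fun_prop), bt_eL _ _ _ (by fun_prop), adj_Z _ (D.OA_T i), R_e, T_e,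
        ← S_T, TR_comm, hl.smul, mul_smul_comm]
    simp only [h1]
    rw [D.coassoc y (fun u v q => D.bt v q (fun v q =>
        D.adj u (D.adj (D.e g) (D.S (D.R g q))) * D.R g v)) (by fun_prop) (by fun_prop)
        (by fun_prop)]
    refine congrArg (D.sw y) (funext fun u => funext fun c => ?_)
    exact (D.cocomm c (f := fun q v => D.adj u (D.adj (D.e g) (D.S (D.R g q))) * D.R g v)).symm
  rw [hL]
  have hR : ∀ p q, (D.bt q (D.e g) fun q x => D.comm (D.adj p x) (D.S q)) =
      D.sw p (fun u v => D.sw q (fun a b => D.adj u (D.adj (D.e g) (D.adj (D.S (D.R g v))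
        (D.S (D.R g a)))) * D.R g b)) := by
    intro p q
    rw [bt_eR _ _ _ (by fun_prop), S_R, comm_Z0 _ (D.OA_R g), sw_S _ _ (by fun_prop) (by fun_prop),
      D.sw_comm]
    refine congrArg (D.sw q) (funext fun a => funext fun b => ?_)
    have hl : Lin k (fun z => D.adj z (D.R g (D.S a)) * D.S (D.R g (D.S b))) := by fun_prop
    rw [adj_e, D.sw_map hl]
    refine congrArg (D.sw p) (funext fun u => funext fun v => ?_)
    rw [adj_mul, adj_mul, ← S_R, ← S_R, S_S]
  simp only [hR]
  rw [D.coassoc4 y (fun u v a b => D.adj u (D.adj (D.e g) (D.adj (D.S (D.R g v))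
        (D.S (D.R g a)))) * D.R g b) (by fun_prop) (by fun_prop) (by fun_prop) (by fun_prop)]
  refine congrArg (D.sw y) (funext fun u => funext fun t => ?_)
  refine congrArg (D.sw t) (funext fun c => funext fun b => ?_)
  have hl : Lin k (fun z => D.adj u (D.adj (D.e g) (D.R g z)) * D.R g b) := by fun_prop
  have h := D.adj_self (D.S c)
  rw [sw_S _ _ (by fun_prop) (by fun_prop)] at h
  rw [S_R, ← h, D.sw_map hl]
  refine congrArg (D.sw c) (funext fun v => funext fun a => ?_)
  rw [adj_Z _ (D.OA_R g), S_R, S_R]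


theorem bt_SeL (j : ι) (y : H) {f : H → H → M} (h1 : ∀ b, Lin k (fun a => f a b))
    (h2 : ∀ a, Lin k (fun b => f a b)) :
    D.bt (D.S (D.e j)) y f = f (D.S (D.e j)) (D.T j y) := by
  refine D.ext1 (f := fun y => D.bt (D.S (D.e j)) y f) (g := fun y => f (D.S (D.e j)) (D.T j y))
    (by fun_prop) (by fun_prop) (fun m => ?_) y
  rw [bt_eR _ _ _ h1, ← S_R, R_e, T_e, map_smul, (h1 _).smul, (h2 _).smul]

theorem S_word (i l j m : ι) :
    D.S (D.e i * D.e l * D.S (D.e j) * D.S (D.e m)) =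
      (D.χ i l * D.χ i j * D.χ i m * D.χ l j * D.χ l m * D.χ j m) •
        (D.e m * D.e j * D.S (D.e l) * D.S (D.e i)) := by
  have h : D.S (D.S (D.e j) * D.S (D.e m)) = D.χ j m • (D.e m * D.e j) := by
    rw [S_mul, bt_SeL _ _ _ (by fun_prop) (by fun_prop), ← S_T, T_e, S_S]
    simp [S_S]
  rw [mul_assoc, mul_assoc, S_mul_eL, map_mul, T_e, smul_mul_assoc, map_smul, S_mul_eL]
  simp only [map_mul, ← S_T, T_e, map_smul, smul_mul_assoc, mul_smul_comm, h, smul_smul]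
  congr 1
  · ring

theorem comm_expand (x y : H) : D.comm x y = D.sw x (fun a b => D.sw y (fun p q =>
    D.bt b p (fun b p => a * p * D.S b * D.S q))) := by
  rw [D.sw_comm]
  unfold comm adj
  refine congrArg (D.sw y) (funext fun p => funext fun q => ?_)
  rw [D.sw_map (F := fun z => z * D.S q) (by fun_prop)]
  refine congrArg (D.sw x) (funext fun a => funext fun b => ?_)
  rw [D.bt_map (F := fun z => z * D.S q) (by fun_prop)]
  simp only [mul_assoc]

theorem S_comm_e (g h : ι) : D.S (D.comm (D.e g) (D.e h)) = D.χ g h • D.comm (D.e h) (D.e g) := by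
  have s1 : D.S (D.comm (D.e g) (D.e h)) = D.sw (D.e g) (fun a b => D.sw (D.e h) (fun p q =>
      D.bt b p (fun b p => D.S (a * p * D.S b * D.S q)))) := by
    rw [comm_expand, D.sw_map (F := fun z => D.S z) (by fun_prop)]
    refine congrArg (D.sw (D.e g)) (funext fun a => funext fun b => ?_)
    rw [D.sw_map (F := fun z => D.S z) (by fun_prop)]
    refine congrArg (D.sw (D.e h)) (funext fun p => funext fun q => ?_)
    rw [D.bt_map (F := fun z => D.S z) (by fun_prop)]
  have s2 : D.S (D.comm (D.e g) (D.e h)) = D.sw (D.e g) (fun a b => D.sw (D.e h) (fun p q =>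
      D.bt a p (fun a p => D.bt a b (fun a b => D.bt a q (fun a q => D.bt b p (fun b p =>
        p * b * D.S q * D.S a)))))) := by
    rw [s1]
    refine D.sw_congr _ fun i j => ?_
    let W : H → H → H := fun p q => D.χ i j •
      (D.T i (D.T j p) * D.e j * D.S (D.T i q) * D.S (D.e i))
    have hW := D.cocomm (D.e h) (f := W)
    refine Eq.trans ?_ (hW.symm.trans ?_)
    · refine D.sw_congr _ fun l m => ?_
      simp only [bt_e, S_word, W, T_e, map_smul, smul_mul_assoc, mul_smul_comm, smul_smul]
      congr 1
      have := D.χ_skew j l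
      linear_combination (D.χ i l * D.χ i j * D.χ i m * D.χ l m * D.χ j m) * this
    · refine D.sw_congr _ fun l m => ?_
      simp only [bt_e, W, T_e, map_smul, smul_mul_assoc, mul_smul_comm, smul_smul]
      congr 1
      ring
  rw [s2, D.sw_comm]
  have s3 : (D.sw (D.e h) fun p q => D.sw (D.e g) fun a b => 
      D.bt a p (fun a p => D.bt a b (fun a b => D.bt a q (fun a q => D.bt b p (fun b p =>
        p * b * D.S q * D.S a))))) = D.sw (D.e h) fun p q => D.sw (D.e g) fun a b =>
        D.bt q a (fun q a => D.T g p * a * D.S (D.T g q) * D.S b) := by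
    refine D.sw_congr _ fun l m => ?_
    let W : H → H → H := fun a b =>
      D.e l * (D.R l a * D.S (D.e m) * D.S (D.R l (D.R m b)))
    have hW := D.cocomm (D.e g) (f := W)
    refine Eq.trans ?_ (hW.symm.trans ?_)
    · refine D.sw_congr _ fun i j => ?_
      simp only [bt_e, W, R_e, map_smul, smul_mul_assoc, mul_smul_comm, smul_smul, mul_assoc]
      congr 1
      ring
    · have o1 := D.Om ((D.Diag_T m).comp (D.Diag_R m)) (D.Diag_R m) (D.S (D.e m)) l (D.e g)
      simp only [AlgHom.comp_apply, TR, R_e] at o1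
      have hl : Lin k (fun z => D.sw z fun a b => a * D.S (D.e m) * D.S (D.R m b)) := by fun_prop
      rw [hl.smul] at o1
      have o2 := D.Om (D.Diag_T m) (D.Diag_id) (D.S (D.e m)) m (D.e g)
      simp only [AlgHom.id_apply, TR, R_e] at o2
      have hl : Lin k (fun z => D.sw z fun a b => D.T m a * D.S (D.e m) * D.S b) := by fun_prop
      rw [hl.smul] at o2
      rw [← o2] at o1
      have o3 : D.sw (D.e g) W = D.e l * (D.χ g l • D.χ g m •
          D.sw (D.e g) fun a b => D.T m a * D.S (D.e m) * D.S b) := by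
        rw [o1, D.sw_map (F := fun z => D.e l * z) (by fun_prop)]
        refine congrArg (D.sw (D.e g)) (funext fun a => funext fun b => ?_)
        simp only [W]
        rw [(D.Diag_R l).comm' (D.Diag_R m)]
      rw [o3]
      have hl : Lin k (fun z : H => D.e l * (D.χ g l • D.χ g m • z)) := by fun_prop
      rw [D.sw_map hl]
      refine D.sw_congr _ fun i j => ?_
      simp only [bt_e, T_e, map_smul, smul_mul_assoc, mul_smul_comm, smul_smul, mul_assoc]
      congr 1
      ring
  rw [s3, D.sw_comm]
  unfold comm
  have hl : Lin k (fun z : H => D.χ g h • z) := by fun_prop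
  rw [D.sw_map hl]
  refine D.sw_congr _ fun i j => ?_
  have o := D.OmT D.Diag_id (D.Diag_R i) (D.e i) g (D.e h)
  have hl : Lin k (fun z => D.sw z fun a b => a * D.e i * D.S (D.R i b)) := by fun_prop
  simp only [AlgHom.id_apply, T_e] at o
  rw [hl.smul] at o
  rw [adj_e, ← smul_mul_assoc, o, D.sw_map (F := fun z => z * D.S (D.e j)) (by fun_prop)]
  refine congrArg (D.sw (D.e h)) (funext fun p => funext fun q => ?_)
  rw [bt_eR _ _ _ (by fun_prop), ← TR_comm]

theorem S_comm (x y : H) : D.S (D.comm x y) = D.bt x y (fun x y => D.comm y x) := by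
  refine D.ext1 (f := fun x => D.S (D.comm x y)) (g := fun x => D.bt x y (fun x y => D.comm y x))
    (by fun_prop) (by fun_prop) (fun i => ?_) x
  refine D.ext1 (f := fun y => D.S (D.comm (D.e i) y))
    (g := fun y => D.bt (D.e i) y (fun x y => D.comm y x))
    (by fun_prop) (by fun_prop) (fun j => ?_) y
  rw [S_comm_e, bt_e]


theorem bt_rel {A : H →ₐ[k] H} {x : H} (hA : D.Rel A x) (w : H) {f : H → H → M}
    (h1 : ∀ b, Lin k (fun a => f a b)) (h2 : ∀ a, Lin k (fun b => f a b)) :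
    D.bt x w f = f x (A w) := by
  refine D.ext1 (f := fun w => D.bt x w f) (g := fun w => f x (A w)) (by fun_prop) (by fun_prop)
    (fun h => ?_) w
  obtain ⟨c, e1, e2⟩ := hA h
  rw [bt_eR _ _ _ h1, e1, e2, (h1 _).smul, (h2 _).smul]

/-- graded submodules -/
def Gr (V : Submodule k H) : Prop :=
  ∀ x ∈ V, x ∈ Submodule.span k {x : H | x ∈ V ∧ ∃ i, D.Rel (D.T i) x}

theorem Gr.ind {D : CHA ι k H} {V : Submodule k H} (hV : D.Gr V) {f : H → M} (hf : Lin k f)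
    {K : Submodule k M} (h : ∀ x ∈ V, ∀ i, D.Rel (D.T i) x → f x ∈ K) : ∀ x ∈ V, f x ∈ K := by
  intro x hx
  have : Submodule.span k {x : H | x ∈ V ∧ ∃ i, D.Rel (D.T i) x} ≤ K.comap hf.toL := by
    rw [Submodule.span_le]
    rintro x ⟨h1, i, h2⟩
    exact h x h1 i h2
  exact this (hV x hx)

theorem Gr.T {D : CHA ι k H} {V : Submodule k H} (hV : D.Gr V) (u : ι) :
    ∀ x ∈ V, D.T u x ∈ V := by
  refine hV.ind (f := fun x => D.T u x) (by fun_prop) (fun x hx i hr => ?_)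
  obtain ⟨c, h1, h2⟩ := hr u
  have hc : c = D.χ i u := by
    rw [T_e] at h2
    have := congrArg (D.e.coord u) h2
    simpa using this.symm
  have h3 := congrArg (D.T u) h1
  rw [TR, map_smul] at h3
  have : D.T u x = c⁻¹ • x := by
    rw [h3, smul_smul, inv_mul_cancel₀ (by rw [hc]; exact D.χ_ne _ _), one_smul]
    exact h3 ▸ rfl
  rw [this]
  exact V.smul_mem _ hx

theorem Gr.bt {D : CHA ι k H} {V W : Submodule k H} (hV : D.Gr V) (hW : D.Gr W)
    {f : H → H → M} (h1 : ∀ b, Lin k (fun a => f a b)) (h2 : ∀ a, Lin k (fun b => f a b))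
    {K : Submodule k M} (h : ∀ x ∈ V, ∀ y ∈ W, f x y ∈ K) (x y : H) (hx : x ∈ V) (hy : y ∈ W) :
    D.bt x y f ∈ K := by
  refine hV.ind (f := fun x => D.bt x y f) (by fun_prop) (fun x hx i hr => ?_) x hx
  rw [D.bt_rel hr _ h1 h2]
  exact h _ hx _ (hW.T _ _ hy)

theorem sw_mem {W : Submodule k H} {y : H}
    (hy : D.Δ y ∈ LinearMap.range (TensorProduct.map W.subtype W.subtype))
    {f : H → H → M} (h1 : ∀ b, Lin k (fun a => f a b)) (h2 : ∀ a, Lin k (fun b => f a b))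
    {K : Submodule k M} (h : ∀ p ∈ W, ∀ q ∈ W, f p q ∈ K) : D.sw y f ∈ K := by
  obtain ⟨t, ht⟩ := hy
  rw [sw, ← ht]
  clear ht
  induction t using TensorProduct.induction_on with
  | zero => rw [map_zero, (D.ev_lin0 f).zero]; exact K.zero_mem
  | tmul a b =>
    rw [TensorProduct.map_tmul, ev_tmul _ _ _ h1 h2]
    exact h _ a.2 _ b.2
  | add s t hs ht =>
    rw [map_add, (D.ev_lin0 f).add]
    exact K.add_mem hs ht

theorem Rel_comm {A B : H →ₐ[k] H} {x y : H} (hA : D.Rel A x) (hB : D.Rel B y) :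
    D.Rel (A.comp B) (D.comm x y) := by
  intro h
  obtain ⟨c, a1, a2⟩ := hA h
  obtain ⟨d, b1, b2⟩ := hB h
  refine ⟨c * d, ?_, ?_⟩
  · have l1 : Lin k (fun z => D.comm z (d • y)) := by fun_prop
    have l2 : Lin k (fun z => D.comm x z) := by fun_prop
    rw [D.comm_Z (D.OA_R h), a1, b1, l1.smul, l2.smul, smul_smul]
  · simp [a2, b2, smul_smul, mul_comm]

theorem S_closed {V W K : Submodule k H} (hV : D.Gr V) (hW : D.Gr W)
    (hΔ : ∀ y ∈ W, D.Δ y ∈ LinearMap.range (TensorProduct.map W.subtype W.subtype))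
    (hS : ∀ y ∈ W, D.S y ∈ W) (hn : ∀ a, ∀ x ∈ V, D.adj a x ∈ V)
    (hg : ∀ x ∈ V, ∀ y ∈ W, D.comm x y ∈ K) (h1 : 1 ∈ K) (hm : ∀ x ∈ K, ∀ y ∈ K, x * y ∈ K)
    (hK : ∀ U : Submodule k H, (∀ x ∈ V, ∀ y ∈ W, D.comm x y ∈ U) → 1 ∈ U →
      (∀ x ∈ U, ∀ y ∈ U, x * y ∈ U) → K ≤ U) : ∀ z ∈ K, D.S z ∈ K := by
  have hJ : ∀ y ∈ W, ∀ x ∈ V, D.comm y x ∈ K := by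
    intro y hy x hx
    rw [comm_J]
    refine D.sw_mem (hΔ y hy) (by fun_prop) (by fun_prop) (fun p hp q hq => ?_)
    refine hW.bt hV (by fun_prop) (by fun_prop) (fun q hq x hx => ?_) q x hq hx
    exact hg _ (hn _ _ hx) _ (hS _ hq)
  have hSg : ∀ x ∈ V, ∀ y ∈ W, D.S (D.comm x y) ∈ K := by
    intro x hx y hy
    rw [S_comm]
    exact hV.bt hW (by fun_prop) (by fun_prop) (fun x hx y hy => hJ y hy x hx) x y hx hy
  have hT : ∀ u, ∀ z ∈ K, D.T u z ∈ K := by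
    intro u
    refine hK (K.comap (D.T u).toLinearMap) ?_ ?_ ?_
    · intro x hx y hy
      simp only [Submodule.mem_comap, AlgHom.toLinearMap_apply, D.comm_Z (D.OA_T u)]
      exact hg _ (hV.T _ _ hx) _ (hW.T _ _ hy)
    · simpa using h1
    · intro x hx y hy
      simp only [Submodule.mem_comap, AlgHom.toLinearMap_apply, map_mul] at *
      exact hm _ hx _ hy
  let K' : Submodule k H := K ⊓ K.comap D.S
  have hT' : ∀ u, ∀ z ∈ K', D.T u z ∈ K' := by
    rintro u z ⟨a, b⟩
    refine ⟨hT u z a, ?_⟩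
    show D.S (D.T u z) ∈ K
    rw [S_T]
    exact hT u _ b
  have o : (1 : H) ∈ K' := ⟨h1, by show D.S 1 ∈ K; rw [S_one]; exact h1⟩
  let U : Submodule k H :=
    { carrier := {z | z ∈ K ∧ ∀ w ∈ K', z * w ∈ K'}
      add_mem' := fun {a b} ha hb => ⟨K.add_mem ha.1 hb.1, fun w hw => by
        rw [add_mul]; exact K'.add_mem (ha.2 w hw) (hb.2 w hw)⟩
      zero_mem' := ⟨K.zero_mem, fun w hw => by rw [zero_mul]; exact K'.zero_mem⟩
      smul_mem' := fun c z hz => ⟨K.smul_mem c hz.1, fun w hw => by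
        rw [smul_mul_assoc]; exact K'.smul_mem c (hz.2 w hw)⟩ }
  have hU : K ≤ U := by
    refine hK U ?_ ⟨h1, fun w hw => by rwa [one_mul]⟩ ?_
    · intro x hx y hy
      refine hV.ind (f := fun x => D.comm x y) (by fun_prop) (fun x hx i hr => ?_) x hx
      refine hW.ind (f := fun y => D.comm x y) (by fun_prop) (fun y hy j hr' => ?_) y hy
      refine ⟨hg x hx y hy, fun w hw => ⟨hm _ (hg x hx y hy) _ hw.1, ?_⟩⟩
      show D.S (D.comm x y * w) ∈ K
      rw [S_mul, D.bt_rel (D.Rel_comm hr hr') w (by fun_prop) (by fun_prop)]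
      exact hm _ (hT' _ _ (hT' _ _ hw)).2 _ (hSg x hx y hy)
    · intro x hx y hy
      refine ⟨hm _ hx.1 _ hy.1, fun w hw => ?_⟩
      rw [mul_assoc]
      exact hx.2 _ (hy.2 _ hw)
  intro z hz
  have := (hU hz).2 1 o
  rw [mul_one] at this
  exact this.2

end CHA

section Bridge

variable {k G H : Type*} [Field k] [CommGroup G] [Ring H] [Algebra k H] (C : ColorHopfAlg k G H)

theorem exists_hbasis : ∃ (s : Set H) (e : Module.Basis s k H) (d : s → G),
    ∀ i, e i ∈ C.grade (d i) := by
  obtain ⟨b, hb, hs, hl⟩ := exists_linearIndependent k {x : H | ∃ g, x ∈ C.grade g}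
  have ht : ⊤ ≤ Submodule.span k (Set.range (Subtype.val : b → H)) := by
    rw [Subtype.range_coe, hs, ← C.grade_top]
    exact iSup_le fun g x hx => Submodule.subset_span ⟨g, hx⟩
  refine ⟨b, Module.Basis.mk hl ht, fun i => (hb i.2).choose, fun i => ?_⟩
  rw [Module.Basis.mk_apply]
  exact (hb i.2).choose_spec

variable {ι : Type*} (e : Module.Basis ι k H) (d : ι → G) (hd : ∀ i, e i ∈ C.grade (d i))

/-- left braiding -/
noncomputable def TL (i : ι) : H →ₗ[k] H := e.constr k (fun j => C.φ (d i) (d j) • e j)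
/-- right braiding -/
noncomputable def RL (i : ι) : H →ₗ[k] H := e.constr k (fun j => C.φ (d j) (d i) • e j)

theorem TL_e (i j : ι) : TL C e d i (e j) = C.φ (d i) (d j) • e j := by simp [TL]
theorem RL_e (i j : ι) : RL C e d i (e j) = C.φ (d j) (d i) • e j := by simp [RL]

theorem TL_grade (hd : ∀ i, e i ∈ C.grade (d i)) (i : ι) (h : G) (p : H) (hp : p ∈ C.grade h) :
    TL C e d i p = C.φ (d i) h • p := by
  have h1 : ∀ p, C.braid (e i ⊗ₜ p) = TL C e d i p ⊗ₜ e i :=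
    Lin.ext_basis e (f := fun p => C.braid (e i ⊗ₜ p)) (g := fun p => TL C e d i p ⊗ₜ e i)
      (by fun_prop) (by fun_prop) (fun j => by
        rw [C.braid_apply _ _ _ _ (hd i) (hd j), TL_e, TensorProduct.smul_tmul'])
  have h2 := h1 p
  rw [C.braid_apply _ _ _ _ (hd i) hp, TensorProduct.smul_tmul'] at h2
  have := congrArg (fun t => (TensorProduct.rid k H) (TensorProduct.map LinearMap.id
    (e.coord i) t)) h2
  simpa using this.symm

theorem RL_grade (hd : ∀ i, e i ∈ C.grade (d i)) (i : ι) (h : G) (p : H) (hp : p ∈ C.grade h) :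
    RL C e d i p = C.φ h (d i) • p := by
  have h1 : ∀ p, C.braid (p ⊗ₜ e i) = e i ⊗ₜ RL C e d i p :=
    Lin.ext_basis e (f := fun p => C.braid (p ⊗ₜ e i)) (g := fun p => e i ⊗ₜ RL C e d i p)
      (by fun_prop) (by fun_prop) (fun j => by
        rw [C.braid_apply _ _ _ _ (hd j) (hd i), RL_e, TensorProduct.tmul_smul])
  have h2 := h1 p
  rw [C.braid_apply _ _ _ _ hp (hd i), ← TensorProduct.tmul_smul] at h2
  have := congrArg (fun t => (TensorProduct.lid k H) (TensorProduct.map (e.coord i)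
    LinearMap.id t)) h2
  simpa using this.symm

theorem φ_one_right (g : G) : C.φ g 1 = 1 := by
  have := C.φ_mul_right g 1 1
  rw [mul_one] at this
  exact (mul_eq_left₀ (C.φ_ne g 1)).1 this.symm
theorem φ_one_left (g : G) : C.φ 1 g = 1 := by
  have := C.φ_mul_left 1 1 g
  rw [mul_one] at this
  exact (mul_eq_left₀ (C.φ_ne 1 g)).1 this.symm

/-- the coordinate version -/
noncomputable def toCHA (hm : C.mul = LinearMap.mul' k H) (h1 : C.one = 1) : CHA ι k H where
  e := e
  χ i j := C.φ (d i) (d j)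
  χ_skew i j := C.φ_skew _ _
  T i := AlgHom.ofLinearMap (TL C e d i)
    (by
      have := C.one_mem
      rw [h1] at this
      rw [TL_grade C e d hd i 1 1 this, φ_one_right, one_smul])
    (fun x y => by
      refine Lin.ext_basis e (f := fun x => TL C e d i (x * y))
        (g := fun x => TL C e d i x * TL C e d i y) (by fun_prop) (by fun_prop) (fun j => ?_) x
      refine Lin.ext_basis e (f := fun y => TL C e d i (e j * y))
        (g := fun y => TL C e d i (e j) * TL C e d i y) (by fun_prop) (by fun_prop) (fun l => ?_) y
      have := C.mul_mem _ _ _ _ (hd j) (hd l)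
      rw [hm, LinearMap.mul'_apply] at this
      rw [TL_grade C e d hd i _ _ this, TL_e, TL_e, C.φ_mul_right, smul_mul_smul_comm])
  R i := AlgHom.ofLinearMap (RL C e d i)
    (by
      have := C.one_mem
      rw [h1] at this
      rw [RL_grade C e d hd i 1 1 this, φ_one_left, one_smul])
    (fun x y => by
      refine Lin.ext_basis e (f := fun x => RL C e d i (x * y))
        (g := fun x => RL C e d i x * RL C e d i y) (by fun_prop) (by fun_prop) (fun j => ?_) x
      refine Lin.ext_basis e (f := fun y => RL C e d i (e j * y))
        (g := fun y => RL C e d i (e j) * RL C e d i y) (by fun_prop) (by fun_prop) (fun l => ?_) y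
      have := C.mul_mem _ _ _ _ (hd j) (hd l)
      rw [hm, LinearMap.mul'_apply] at this
      rw [RL_grade C e d hd i _ _ this, RL_e, RL_e, C.φ_mul_left, smul_mul_smul_comm])
  T_e i j := TL_e C e d i j
  R_e i j := RL_e C e d i j
  br := C.braid
  br_e i j := C.braid_apply _ _ _ _ (hd i) (hd j)
  Δ := C.comul
  ε := C.counit
  S := C.antipode
  S_T i x := by
    refine Lin.ext_basis e (f := fun x => C.antipode (TL C e d i x))
        (g := fun x => TL C e d i (C.antipode x)) (by fun_prop) (by fun_prop) (fun j => ?_) x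
    rw [TL_e, map_smul, TL_grade C e d hd i _ _ (C.antipode_mem _ _ (hd j))]
  S_R i x := by
    refine Lin.ext_basis e (f := fun x => C.antipode (RL C e d i x))
        (g := fun x => RL C e d i (C.antipode x)) (by fun_prop) (by fun_prop) (fun j => ?_) x
    rw [RL_e, map_smul, RL_grade C e d hd i _ _ (C.antipode_mem _ _ (hd j))]
  coassoc' := C.coassoc
  counit_left' := C.counit_left
  counit_right' := C.counit_right
  Δ_one := by rw [← h1]; exact C.comul_one
  ε_one := by rw [← h1]; exact C.counit_one
  ε_mul x y := by have := C.counit_mul x y; rwa [hm] at this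
  Δ_mul' := by rw [← hm]; exact C.comul_mul
  cocomm' x := LinearMap.congr_fun C.cocomm x
  S_left' x := by rw [← hm, ← h1]; exact C.antipode_left x
  S_right' x := by rw [← hm, ← h1]; exact C.antipode_right x

section
variable (hm : C.mul = LinearMap.mul' k H) (h1 : C.one = 1)

theorem toCHA_adj (a r : H) : C.adj (a ⊗ₜ r) = (toCHA C e d hd hm h1).adj a r := by
  set D := toCHA C e d hd hm h1 with hD
  have b1 : C.braid = D.br := rfl
  have b2 : C.antipode = D.S := rfl
  have b3 : C.comul = D.Δ := rfl
  unfold ColorHopfAlg.adj CHA.adj CHA.sw CHA.bt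
  simp only [LinearMap.comp_apply, TensorProduct.map_tmul, LinearMap.id_apply, hm, b1, b2, b3]
  generalize D.Δ a = t
  rw [D.ev_of (F := fun t => LinearMap.mul' k H (TensorProduct.map LinearMap.id
    (LinearMap.mul' k H ∘ₗ (TensorProduct.map LinearMap.id D.S) ∘ₗ D.br)
      ((TensorProduct.assoc k H H H).toLinearMap (t ⊗ₜ r)))) (by fun_prop)]
  refine congrArg (D.ev t) (funext fun a => funext fun b => ?_)
  simp only [LinearEquiv.coe_coe, TensorProduct.assoc_tmul, TensorProduct.map_tmul,
    LinearMap.mul'_apply, LinearMap.comp_apply, LinearMap.id_apply]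
  rw [D.ev_of (F := fun t => a * LinearMap.mul' k H (TensorProduct.map LinearMap.id D.S t))
    (by fun_prop)]
  simp

theorem toCHA_comm (x y : H) : C.commMap (x ⊗ₜ y) = (toCHA C e d hd hm h1).comm x y := by
  have ha := toCHA_adj C e d hd hm h1
  set D := toCHA C e d hd hm h1 with hD
  have b2 : C.antipode = D.S := rfl
  have b3 : C.comul = D.Δ := rfl
  unfold ColorHopfAlg.commMap CHA.comm CHA.sw
  simp only [LinearMap.comp_apply, TensorProduct.map_tmul, LinearMap.id_apply, hm, b2, b3]
  rw [D.ev_of (F := fun t => LinearMap.mul' k H (TensorProduct.map C.adj D.S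
      ((TensorProduct.assoc k H H H).symm.toLinearMap (x ⊗ₜ t)))) (by fun_prop)]
  simp [ha]

theorem toCHA_rel (g : G) (x : H) (hx : x ∈ C.grade g) (h0 : x ≠ 0) :
    ∃ i, (toCHA C e d hd hm h1).Rel ((toCHA C e d hd hm h1).T i) x := by
  have : ∃ i, e.repr x i ≠ 0 := by
    by_contra hc
    push Not at hc
    exact h0 (e.repr.map_eq_zero_iff.1 (Finsupp.ext hc))
  obtain ⟨i, hi⟩ := this
  have key : ∀ h, C.φ g (d h) = C.φ (d i) (d h) := by
    intro h
    have e1 := RL_grade C e d hd h g x hx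
    have e2 : ∀ x, e.coord i (RL C e d h x) = C.φ (d i) (d h) * e.coord i x := by
      refine Lin.ext_basis e (f := fun x => e.coord i (RL C e d h x))
        (g := fun x => C.φ (d i) (d h) • e.coord i x) (by fun_prop) (by fun_prop) (fun j => ?_)
      classical
      simp only [RL_e, map_smul, Module.Basis.coord_apply, Module.Basis.repr_self,
        Finsupp.single_apply, smul_eq_mul]
      split_ifs with hj
      · rw [hj]
      · simp
    have e3 := e2 x
    rw [e1, map_smul, smul_eq_mul] at e3
    exact mul_right_cancel₀ (b := e.coord i x) hi e3
  refine ⟨i, fun h => ⟨C.φ g (d h), RL_grade C e d hd h g x hx, ?_⟩⟩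
  rw [key]
  exact TL_e C e d i h

theorem toCHA_Gr {V : Submodule k H} (hV : C.IsCHSub V) : (toCHA C e d hd hm h1).Gr V := by
  intro x hx
  have := hV.graded x hx
  refine Submodule.span_le.2 ?_ this
  rintro y ⟨hy, g, hg⟩
  by_cases h0 : y = 0
  · rw [h0]; exact Submodule.zero_mem _
  · exact Submodule.subset_span ⟨hy, toCHA_rel C e d hd hm h1 g y hg h0⟩

end

theorem main_aux (hm : C.mul = LinearMap.mul' k H) (h1 : C.one = 1)
    (V W : Submodule k H) (hV : C.IsCHSub V) (hW : C.IsCHSub W)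
    (hVn : C.IsNormal V) :
    (∀ (g h : G) (x y : H), x ∈ V → x ∈ C.grade g → y ∈ W → y ∈ C.grade h →
      C.antipode (C.commMap (x ⊗ₜ[k] y)) = C.φ g h • C.commMap (y ⊗ₜ[k] x)) ∧
    (∀ z ∈ C.commSub V W, C.antipode z ∈ C.commSub V W) := by
  obtain ⟨s, e, d, hd⟩ := exists_hbasis C
  have ha := toCHA_adj C e d hd hm h1
  have hc := toCHA_comm C e d hd hm h1
  have gV := toCHA_Gr C e d hd hm h1 hV
  have gW := toCHA_Gr C e d hd hm h1 hW
  have hbr : C.braid = (toCHA C e d hd hm h1).br := rfl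
  have hSe : C.antipode = (toCHA C e d hd hm h1).S := rfl
  have hΔe : C.comul = (toCHA C e d hd hm h1).Δ := rfl
  generalize toCHA C e d hd hm h1 = D at *
  constructor
  · intro g h x y _ hx _ hy
    rw [hc, hc, hSe, D.S_comm, CHA.bt, ← hbr, C.braid_apply _ _ _ _ hx hy, (D.ev_lin0 _).smul,
      D.ev_tmul _ _ (by fun_prop) (by fun_prop)]
  · have hmul : ∀ x y, C.mul (x ⊗ₜ y) = x * y := fun x y => by rw [hm, LinearMap.mul'_apply]
    rw [hSe]
    refine D.S_closed gV gW ?_ ?_ ?_ ?_ ?_ ?_ ?_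
    · intro y hy; rw [← hΔe]; exact hW.comul_mem y hy
    · intro y hy; rw [← hSe]; exact hW.antipode_mem y hy
    · intro a x hx; rw [← ha]; exact hVn a x hx
    · intro x hx y hy
      rw [← hc]
      exact Submodule.mem_sInf.2 fun U hU => hU.1 ⟨x, hx, y, hy, rfl⟩
    · rw [← h1]
      exact Submodule.mem_sInf.2 fun U hU => hU.2.1
    · intro x hx y hy
      rw [← hmul]
      exact Submodule.mem_sInf.2 fun U hU => hU.2.2 x (Submodule.mem_sInf.1 hx U hU) y
        (Submodule.mem_sInf.1 hy U hU)
    · intro U u1 u2 u3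
      refine sInf_le ⟨?_, ?_, ?_⟩
      · rintro z ⟨x, hx, y, hy, rfl⟩
        rw [hc]; exact u1 x hx y hy
      · rw [h1]; exact u2
      · intro x hx y hy
        rw [hmul]; exact u3 x hx y hy

end Bridge

section Final
variable {k G H : Type*} [Field k] [CommGroup G] [AddCommGroup H] [Module k H]
  (C : ColorHopfAlg k G H)

/-- ring structure -/
abbrev ringOf : Ring H :=
  { (inferInstance : AddCommGroup H) with
    mul := fun x y => C.mul (x ⊗ₜ y)
    one := C.one
    mul_assoc := C.mul_assoc'
    one_mul := C.one_mul'
    mul_one := C.mul_one'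
    left_distrib := fun a b c => by
      show C.mul (a ⊗ₜ (b + c)) = C.mul (a ⊗ₜ b) + C.mul (a ⊗ₜ c)
      rw [TensorProduct.tmul_add, map_add]
    right_distrib := fun a b c => by
      show C.mul ((a + b) ⊗ₜ c) = C.mul (a ⊗ₜ c) + C.mul (b ⊗ₜ c)
      rw [TensorProduct.add_tmul, map_add]
    zero_mul := fun a => by
      show C.mul (0 ⊗ₜ a) = 0
      rw [TensorProduct.zero_tmul, map_zero]
    mul_zero := fun a => by
      show C.mul (a ⊗ₜ 0) = 0
      rw [TensorProduct.tmul_zero, map_zero] }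

/-- algebra structure -/
abbrev algOf : @Algebra k H _ (ringOf C).toSemiring :=
  letI := ringOf C
  Algebra.ofModule
    (fun r x y => by
      show C.mul ((r • x) ⊗ₜ y) = r • C.mul (x ⊗ₜ y)
      rw [← TensorProduct.smul_tmul', map_smul])
    (fun r x y => by
      show C.mul (x ⊗ₜ (r • y)) = r • C.mul (x ⊗ₜ y)
      rw [TensorProduct.tmul_smul, map_smul])

end Final

end Abstract

section Statements

variable {H : Type*} [AddCommGroup H] [Module k H]

/-- `S([x,y]) = φ(|x|,|y|) [y,x]` for homogeneous `x ∈ X`, `y ∈ Y`; in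
particular `[X,Y]` is closed under the antipode. -/
theorem antipode_commutator (C : ColorHopfAlg k G H)
    (V W : Submodule k H) (hV : C.IsCHSub V) (hW : C.IsCHSub W)
    (hVn : C.IsNormal V) (hWn : C.IsNormal W) :
    (∀ (g h : G) (x y : H), x ∈ V → x ∈ C.grade g → y ∈ W → y ∈ C.grade h →
      C.antipode (C.commMap (x ⊗ₜ[k] y)) = C.φ g h • C.commMap (y ⊗ₜ[k] x)) ∧
    (∀ z ∈ C.commSub V W, C.antipode z ∈ C.commSub V W) := by
  exact @main_aux k G H _ _ (ringOf C) (algOf C) C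
    (by apply TensorProduct.ext'; intro x y; rfl) rfl V W hV hW hVn

end Statements

end ColorHopfPaper
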